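/- arXiv:1607.00481 — 7 statements merged into one kernel-verified Lean document; each statement's English description precedes it below -/
import Mathlib

section
/- Let b ∈ ℂ with b ∉ {0, i, −i} and set q = (1−ib)/(1+ib). Let S_x be the ℂ-algebra with generators x₀, x₁, x₂, x₃ and relations x₀x₁ − x₁x₀ = 0, 2x₀x₁ = x₂x₃ − x₃x₂, x₀x₂ − x₂x₀ = b²(x₁x₃ + x₃x₁), x₀x₂ + x₂x₀ = x₃x₁ − x₁x₃, x₀x₃ − x₃x₀ = −b²(x₁x₂ + x₂x₁), x₀x₃ + x₃x₀ = x₁x₂ − x₂x₁. Then the assignment E ↦ (i/2)(1−ib)(x₂+ix₃), F ↦ (i/2)(1+ib)(x₂−ix₃), K ↦ x₀+bx₁, K′ ↦ x₀−bx₁ induces a ℂ-algebra isomorphism from the algebra presented by generators E, F, K, K′ and relations KE = qEK, KF = q⁻¹FK, KK′ = K′K, K′E = q⁻¹EK′, K′F = qFK′, (q − q⁻¹)(EF − FE) = K² − K′², onto S_x. -/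
noncomputable section

open FreeAlgebra Complex

/-- Relations of the algebra `S_x`, with generators `0 ↦ x₀`, `1 ↦ x₁`, `2 ↦ x₂`, `3 ↦ x₃`:
`[x₀,x₁] = 0`, `{x₀,x₁} = 2x₀x₁ = [x₂,x₃]`, `[x₀,x₂] = b²{x₁,x₃}`, `{x₀,x₂} = [x₃,x₁]`,
`[x₀,x₃] = −b²{x₁,x₂}`, `{x₀,x₃} = [x₁,x₂]`. -/
inductive SxRel (b : ℂ) : FreeAlgebra ℂ (Fin 4) → FreeAlgebra ℂ (Fin 4) → Prop
  | r1 : SxRel b (ι ℂ 0 * ι ℂ 1 - ι ℂ 1 * ι ℂ 0) 0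
  | r2 : SxRel b ((2 : ℂ) • (ι ℂ 0 * ι ℂ 1)) (ι ℂ 2 * ι ℂ 3 - ι ℂ 3 * ι ℂ 2)
  | r3 : SxRel b (ι ℂ 0 * ι ℂ 2 - ι ℂ 2 * ι ℂ 0)
      ((b ^ 2) • (ι ℂ 1 * ι ℂ 3 + ι ℂ 3 * ι ℂ 1))
  | r4 : SxRel b (ι ℂ 0 * ι ℂ 2 + ι ℂ 2 * ι ℂ 0) (ι ℂ 3 * ι ℂ 1 - ι ℂ 1 * ι ℂ 3)
  | r5 : SxRel b (ι ℂ 0 * ι ℂ 3 - ι ℂ 3 * ι ℂ 0)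
      ((-(b ^ 2)) • (ι ℂ 1 * ι ℂ 2 + ι ℂ 2 * ι ℂ 1))
  | r6 : SxRel b (ι ℂ 0 * ι ℂ 3 + ι ℂ 3 * ι ℂ 0) (ι ℂ 1 * ι ℂ 2 - ι ℂ 2 * ι ℂ 1)

/-- The algebra `S_x`. -/
abbrev SxAlg (b : ℂ) : Type := RingQuot (SxRel b)

/-- The generators `x₀, x₁, x₂, x₃` of `S_x`. -/
def gx (b : ℂ) (j : Fin 4) : SxAlg b := RingQuot.mkAlgHom ℂ (SxRel b) (ι ℂ j)

/-- Relations of the algebra presented by `E, F, K, K′`, with generators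
`0 ↦ E`, `1 ↦ F`, `2 ↦ K`, `3 ↦ K′`:
`KE = qEK`, `KF = q⁻¹FK`, `KK′ = K′K`, `K′E = q⁻¹EK′`, `K′F = qFK′`,
`(q − q⁻¹)(EF − FE) = K² − K′²`. -/
inductive SRel (q : ℂ) : FreeAlgebra ℂ (Fin 4) → FreeAlgebra ℂ (Fin 4) → Prop
  | KE : SRel q (ι ℂ 2 * ι ℂ 0) (q • (ι ℂ 0 * ι ℂ 2))
  | KF : SRel q (ι ℂ 2 * ι ℂ 1) (q⁻¹ • (ι ℂ 1 * ι ℂ 2))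
  | KK' : SRel q (ι ℂ 2 * ι ℂ 3) (ι ℂ 3 * ι ℂ 2)
  | K'E : SRel q (ι ℂ 3 * ι ℂ 0) (q⁻¹ • (ι ℂ 0 * ι ℂ 3))
  | K'F : SRel q (ι ℂ 3 * ι ℂ 1) (q • (ι ℂ 1 * ι ℂ 3))
  | EF : SRel q ((q - q⁻¹) • (ι ℂ 0 * ι ℂ 1 - ι ℂ 1 * ι ℂ 0))
      (ι ℂ 2 * ι ℂ 2 - ι ℂ 3 * ι ℂ 3)

/-- The algebra presented by `E, F, K, K′` and the above relations. -/
abbrev SAlg (q : ℂ) : Type := RingQuot (SRel q)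

def gE (q : ℂ) : SAlg q := RingQuot.mkAlgHom ℂ (SRel q) (ι ℂ 0)
def gF (q : ℂ) : SAlg q := RingQuot.mkAlgHom ℂ (SRel q) (ι ℂ 1)
def gK (q : ℂ) : SAlg q := RingQuot.mkAlgHom ℂ (SRel q) (ι ℂ 2)
def gK' (q : ℂ) : SAlg q := RingQuot.mkAlgHom ℂ (SRel q) (ι ℂ 3)

lemma one_add_I_mul_ne_zero {b : ℂ} (hbi : b ≠ I) : 1 + I * b ≠ 0 := fun h ↦
  hbi (by linear_combination (-I) * h + b * I_sq)

lemma one_sub_I_mul_ne_zero {b : ℂ} (hbni : b ≠ -I) : 1 - I * b ≠ 0 := fun h ↦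
  hbni (by linear_combination I * h + b * I_sq)

lemma gx_relations (b : ℂ) :
    gx b 0 * gx b 1 - gx b 1 * gx b 0 = 0 ∧
    (2 : ℂ) • (gx b 0 * gx b 1) = gx b 2 * gx b 3 - gx b 3 * gx b 2 ∧
    gx b 0 * gx b 2 - gx b 2 * gx b 0 = (b ^ 2) • (gx b 1 * gx b 3 + gx b 3 * gx b 1) ∧
    gx b 0 * gx b 2 + gx b 2 * gx b 0 = gx b 3 * gx b 1 - gx b 1 * gx b 3 ∧
    gx b 0 * gx b 3 - gx b 3 * gx b 0 = (-(b ^ 2)) • (gx b 1 * gx b 2 + gx b 2 * gx b 1) ∧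
    gx b 0 * gx b 3 + gx b 3 * gx b 0 = gx b 1 * gx b 2 - gx b 2 * gx b 1 := by
  simp only [gx, ← map_mul, ← map_sub, ← map_add, ← map_smul]
  exact ⟨(RingQuot.mkAlgHom_rel ℂ .r1).trans (map_zero _), RingQuot.mkAlgHom_rel ℂ .r2,
    RingQuot.mkAlgHom_rel ℂ .r3, RingQuot.mkAlgHom_rel ℂ .r4,
    RingQuot.mkAlgHom_rel ℂ .r5, RingQuot.mkAlgHom_rel ℂ .r6⟩

lemma SAlg_relations (q : ℂ) :
    gK q * gE q = q • (gE q * gK q) ∧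
    gK q * gF q = q⁻¹ • (gF q * gK q) ∧
    gK q * gK' q = gK' q * gK q ∧
    gK' q * gE q = q⁻¹ • (gE q * gK' q) ∧
    gK' q * gF q = q • (gF q * gK' q) ∧
    (q - q⁻¹) • (gE q * gF q - gF q * gE q) = gK q * gK q - gK' q * gK' q := by
  simp only [gE, gF, gK, gK', ← map_mul, ← map_sub, ← map_smul]
  exact ⟨RingQuot.mkAlgHom_rel ℂ .KE, RingQuot.mkAlgHom_rel ℂ .KF,
    RingQuot.mkAlgHom_rel ℂ .KK', RingQuot.mkAlgHom_rel ℂ .K'E,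
    RingQuot.mkAlgHom_rel ℂ .K'F, RingQuot.mkAlgHom_rel ℂ .EF⟩

/-- The images of `E, F, K, K′` in `S_x`. -/
def sxOfS (b : ℂ) : Fin 4 → SxAlg b :=
  ![(I / 2 * (1 - I * b)) • (gx b 2 + I • gx b 3),
    (I / 2 * (1 + I * b)) • (gx b 2 - I • gx b 3),
    gx b 0 + b • gx b 1, gx b 0 - b • gx b 1]

/-- The preimages of `x₀, x₁, x₂, x₃` in the algebra presented by `E, F, K, K′`. -/
def sOfSx (b q : ℂ) : Fin 4 → SAlg q :=
  ![(1 / 2 : ℂ) • (gK q + gK' q), (1 / (2 * b)) • (gK q - gK' q),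
    (1 / (I * (1 - I * b))) • gE q + (1 / (I * (1 + I * b))) • gF q,
    (-1 / (1 - I * b)) • gE q + (1 / (1 + I * b)) • gF q]

lemma lift_sxOfS_eq_of_rel {b q : ℂ} (hc : 1 - I * b ≠ 0) (hd : 1 + I * b ≠ 0)
    (hq : q = (1 - I * b) / (1 + I * b)) {r s : FreeAlgebra ℂ (Fin 4)} (h : SRel q r s) :
    FreeAlgebra.lift ℂ (sxOfS b) r = FreeAlgebra.lift ℂ (sxOfS b) s := by
  have hI : I ^ 2 = -1 := I_sq
  unfold sxOfS
  generalize hc₀ : 1 - I * b = c at *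
  generalize hd₀ : 1 + I * b = d at *
  obtain ⟨h₁, h₂, h₃, h₄, h₅, h₆⟩ := gx_relations b
  cases h <;>
  simp only [map_mul, map_sub, map_smul, FreeAlgebra.lift_ι_apply, hq, inv_div,
    Matrix.cons_val, mul_add, add_mul, mul_sub, sub_mul, smul_mul_assoc, mul_smul_comm]
  case KE =>
    linear_combination (norm := (match_scalars <;> field_simp <;> clear * - hI hc₀ hd₀ <;> grind))
      (I * c / (2 * d)) • (h₃ + I • h₅ + (I * b) • (h₄ + I • h₆))
  case KF =>
    linear_combination (norm := (match_scalars <;> field_simp <;> clear * - hI hc₀ hd₀ <;> grind))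
      (I * d / (2 * c)) • (h₃ - I • h₅ - (I * b) • (h₄ - I • h₆))
  case KK' =>
    linear_combination (norm := (match_scalars <;> field_simp <;> clear * - hI hc₀ hd₀ <;> grind))
      (-2 * b) • h₁
  case K'E =>
    linear_combination (norm := (match_scalars <;> field_simp <;> clear * - hI hc₀ hd₀ <;> grind))
      (I / 2) • (h₃ + I • h₅ - (I * b) • (h₄ + I • h₆))
  case K'F =>
    linear_combination (norm := (match_scalars <;> field_simp <;> clear * - hI hc₀ hd₀ <;> grind))
      (I / 2) • (h₃ - I • h₅ + (I * b) • (h₄ - I • h₆))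
  case EF =>
    linear_combination (norm := (match_scalars <;> field_simp <;> clear * - hI hc₀ hd₀ <;> grind))
      (-2 * b) • h₂ + (2 * b) • h₁

lemma lift_sOfSx_eq_of_rel {b q : ℂ} (hb : b ≠ 0) (hc : 1 - I * b ≠ 0) (hd : 1 + I * b ≠ 0)
    (hq : q = (1 - I * b) / (1 + I * b)) {r s : FreeAlgebra ℂ (Fin 4)} (h : SxRel b r s) :
    FreeAlgebra.lift ℂ (sOfSx b q) r = FreeAlgebra.lift ℂ (sOfSx b q) s := by
  have hI : I ^ 2 = -1 := I_sq
  have hI₀ := I_ne_zero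
  obtain ⟨hKE, hKF, hKK', hK'E, hK'F, hEF⟩ := SAlg_relations q
  unfold sOfSx
  generalize hc₀ : 1 - I * b = c at *
  generalize hd₀ : 1 + I * b = d at *
  subst hq
  simp only [inv_div] at hKF hK'E hEF
  cases h <;>
  simp only [map_mul, map_sub, map_add, map_smul, map_zero, FreeAlgebra.lift_ι_apply,
    Matrix.cons_val, mul_add, add_mul, mul_sub, sub_mul, smul_mul_assoc, mul_smul_comm]
  case r1 =>
    linear_combination (norm := (match_scalars <;> field_simp <;> clear * - hI hc₀ hd₀ <;> grind))
      (-1 / (2 * b)) • hKK'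
  case r2 =>
    linear_combination (norm := (match_scalars <;> field_simp <;> clear * - hI hc₀ hd₀ <;> grind))
      (-1 / (2 * b)) • hEF - (1 / (2 * b)) • hKK'
  case r3 =>
    linear_combination (norm := (match_scalars <;> field_simp <;> clear * - hI hc₀ hd₀ <;> grind))
      (1 / (2 * I)) • ((d / c) • hKE + hK'E + (c / d) • hKF + hK'F)
  case r4 =>
    linear_combination (norm := (match_scalars <;> field_simp <;> clear * - hI hc₀ hd₀ <;> grind))
      (-1 / (2 * b)) • ((d / c) • hKE - hK'E - (c / d) • hKF + hK'F)
  case r5 =>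
    linear_combination (norm := (match_scalars <;> field_simp <;> clear * - hI hc₀ hd₀ <;> grind))
      (-1 / 2 : ℂ) • ((d / c) • hKE + hK'E - (c / d) • hKF - hK'F)
  case r6 =>
    linear_combination (norm := (match_scalars <;> field_simp <;> clear * - hI hc₀ hd₀ <;> grind))
      (-1 / (2 * b * I)) • ((d / c) • hKE - hK'E + (c / d) • hKF - hK'F)

/-- The assignment `E ↦ (i/2)(1−ib)(x₂+ix₃)`, `F ↦ (i/2)(1+ib)(x₂−ix₃)`, `K ↦ x₀+bx₁`,
`K′ ↦ x₀−bx₁` induces a ℂ-algebra isomorphism from the algebra presented by `E, F, K, K′`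
(with `q = (1−ib)/(1+ib)`) onto `S_x`. -/
theorem stmt_0 (b : ℂ) (hb0 : b ≠ 0) (hbi : b ≠ I) (hbni : b ≠ -I)
    (q : ℂ) (hq : q = (1 - I * b) / (1 + I * b)) :
    ∃ φ : SAlg q ≃ₐ[ℂ] SxAlg b,
      φ (gE q) = (I / 2 * (1 - I * b)) • (gx b 2 + I • gx b 3) ∧
      φ (gF q) = (I / 2 * (1 + I * b)) • (gx b 2 - I • gx b 3) ∧
      φ (gK q) = gx b 0 + b • gx b 1 ∧
      φ (gK' q) = gx b 0 - b • gx b 1 := by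
  have hc := one_sub_I_mul_ne_zero hbni
  have hd := one_add_I_mul_ne_zero hbi
  have hI : I ^ 2 = -1 := I_sq
  have hI₀ := I_ne_zero
  let f : SAlg q →ₐ[ℂ] SxAlg b := RingQuot.liftAlgHom ℂ
    ⟨FreeAlgebra.lift ℂ (sxOfS b), fun {_ _} ↦ lift_sxOfS_eq_of_rel hc hd hq⟩
  let g : SxAlg b →ₐ[ℂ] SAlg q := RingQuot.liftAlgHom ℂ
    ⟨FreeAlgebra.lift ℂ (sOfSx b q), fun {_ _} ↦ lift_sOfSx_eq_of_rel hb0 hc hd hq⟩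
  have hf (j : Fin 4) : f (RingQuot.mkAlgHom ℂ (SRel q) (ι ℂ j)) = sxOfS b j := by simp [f]
  have hg (j : Fin 4) : g (gx b j) = sOfSx b q j := by simp [g, gx]
  have hE : f (gE q) = sxOfS b 0 := hf 0
  have hF : f (gF q) = sxOfS b 1 := hf 1
  have hK : f (gK q) = sxOfS b 2 := hf 2
  have hK' : f (gK' q) = sxOfS b 3 := hf 3
  have hfg : f.comp g = AlgHom.id ℂ _ := by
    refine RingQuot.ringQuot_ext' (S := ℂ) _ _ (FreeAlgebra.hom_ext (funext fun j ↦ ?_))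
    change f (g (gx b j)) = gx b j
    rw [hg]
    fin_cases j <;>
    simp [sOfSx, hE, hF, hK, hK'] <;> simp [sxOfS] <;> match_scalars <;> grind
  have hgf : g.comp f = AlgHom.id ℂ _ := by
    refine RingQuot.ringQuot_ext' (S := ℂ) _ _ (FreeAlgebra.hom_ext (funext fun j ↦ ?_))
    change g (f (RingQuot.mkAlgHom ℂ (SRel q) (ι ℂ j))) = RingQuot.mkAlgHom ℂ (SRel q) (ι ℂ j)
    rw [hf]
    fin_cases j <;>
    simp [sxOfS, hg] <;> simp [sOfSx, gE, gF, gK, gK'] <;> match_scalars <;> grind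
  exact ⟨AlgEquiv.ofAlgHom f g hfg hgf, hE, hF, hK, hK'⟩
end
end

section
/- For λ ∈ ℂ ∖ {0}, set Ω(λ) = EF + κ²(q⁻¹K − qλK′)(K − λ⁻¹K′) ∈ S. Then: (i) Ω(λ) = FE + κ²(qK − q⁻¹λ⁻¹K′)(K − λK′) in S; (ii) Ω(λ) commutes with each of E, F, K, K′, hence is central in S; (iii) KK′ is central in S. -/
noncomputable section

open FreeAlgebra

/-- The central element `Ω(λ) = EF + κ²(q⁻¹K − qλK′)(K − λ⁻¹K′)`. -/
def Omega (q κ l : ℂ) : SAlg q :=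
  gE q * gF q + κ ^ 2 • ((q⁻¹ • gK q - (q * l) • gK' q) * (gK q - l⁻¹ • gK' q))

theorem gK_mul_gE (q : ℂ) : gK q * gE q = q • (gE q * gK q) := by
  simpa [gK, gE] using RingQuot.mkAlgHom_rel ℂ (SRel.KE (q := q))

theorem gK_mul_gF (q : ℂ) : gK q * gF q = q⁻¹ • (gF q * gK q) := by
  simpa [gK, gF] using RingQuot.mkAlgHom_rel ℂ (SRel.KF (q := q))

theorem gK_mul_gK' (q : ℂ) : gK q * gK' q = gK' q * gK q := by
  simpa [gK, gK'] using RingQuot.mkAlgHom_rel ℂ (SRel.KK' (q := q))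

theorem gK'_mul_gE (q : ℂ) : gK' q * gE q = q⁻¹ • (gE q * gK' q) := by
  simpa [gK', gE] using RingQuot.mkAlgHom_rel ℂ (SRel.K'E (q := q))

theorem gK'_mul_gF (q : ℂ) : gK' q * gF q = q • (gF q * gK' q) := by
  simpa [gK', gF] using RingQuot.mkAlgHom_rel ℂ (SRel.K'F (q := q))

theorem smul_commutator_gE_gF (q : ℂ) :
    (q - q⁻¹) • (gE q * gF q - gF q * gE q) = gK q * gK q - gK' q * gK' q := by
  simpa only [map_smul, map_sub, map_mul, gE, gF, gK, gK'] using RingQuot.mkAlgHom_rel ℂ (SRel.EF (q := q))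

/-- An element commuting with the four generators of `S` is central. -/
theorem mem_center_of_commute_generators {q : ℂ} {x : SAlg q} (hE : Commute x (gE q))
    (hF : Commute x (gF q)) (hK : Commute x (gK q)) (hK' : Commute x (gK' q)) :
    x ∈ Subalgebra.center ℂ (SAlg q) := by
  rw [Subalgebra.mem_center_iff]
  intro b
  obtain ⟨a, rfl⟩ := RingQuot.mkAlgHom_surjective ℂ (SRel q) b
  suffices h : Commute x (RingQuot.mkAlgHom ℂ (SRel q) a) from h.eq.symm
  induction a using FreeAlgebra.induction with
  | grade0 r =>
    rw [AlgHom.commutes]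
    exact Algebra.commutes' r x |>.symm
  | grade1 i =>
    fin_cases i
    exacts [hE, hF, hK, hK']
  | mul a b ha hb => rw [map_mul]; exact ha.mul_right hb
  | add a b ha hb => rw [map_add]; exact ha.add_right hb

theorem linear_mul_gE (q a b : ℂ) :
    (a • gK q - b • gK' q) * gE q = gE q * ((q * a) • gK q - (q⁻¹ * b) • gK' q) := by
  simp only [sub_mul, mul_sub, smul_mul_assoc, mul_smul_comm, gK_mul_gE, gK'_mul_gE]
  module

theorem linear_mul_gF (q a b : ℂ) :
    (a • gK q - b • gK' q) * gF q = gF q * ((q⁻¹ * a) • gK q - (q * b) • gK' q) := by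
  simp only [sub_mul, mul_sub, smul_mul_assoc, mul_smul_comm, gK_mul_gF, gK'_mul_gF]
  module

theorem linear_mul_linear (q a b c d : ℂ) :
    (a • gK q - b • gK' q) * (c • gK q - d • gK' q) =
      (a * c) • (gK q * gK q) - (a * d + b * c) • (gK q * gK' q)
        + (b * d) • (gK' q * gK' q) := by
  simp only [sub_mul, mul_sub, smul_mul_assoc, mul_smul_comm, ← gK_mul_gK']
  module

theorem commute_gK_linear (q a b : ℂ) : Commute (a • gK q - b • gK' q) (gK q) :=
  ((Commute.refl _).smul_left a).sub_left (Commute.smul_left (gK_mul_gK' q).symm b)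

theorem commute_gK'_linear (q a b : ℂ) : Commute (a • gK q - b • gK' q) (gK' q) :=
  (Commute.smul_left (gK_mul_gK' q) a).sub_left ((Commute.refl _).smul_left b)

/-- If `x` scales `y` by `a` and `z` by `b` with `b * a = 1`, then `x` commutes with `y * z`. -/
theorem commute_mul_of_smul {A : Type*} [Ring A] [Algebra ℂ A] {x y z : A} {a b : ℂ}
    (hy : x * y = a • (y * x)) (hz : x * z = b • (z * x)) (hab : b * a = 1) :
    Commute (y * z) x := by
  refine Eq.symm ?_
  rw [← mul_assoc, hy, smul_mul_assoc, mul_assoc, hz, mul_smul_comm, smul_smul, mul_comm a b,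
    hab, one_smul, mul_assoc]

theorem Omega_eq (q κ l : ℂ) :
    Omega q κ l = gE q * gF q + κ ^ 2 •
      ((q⁻¹ • gK q - (q * l) • gK' q) * ((1 : ℂ) • gK q - l⁻¹ • gK' q)) := by
  rw [one_smul, Omega]

theorem Omega_eq_gF_mul_gE {q κ l : ℂ} (hq : q⁻¹ - q ≠ 0) (hκ : κ = (q⁻¹ - q)⁻¹)
    (hq0 : q ≠ 0) (hl : l ≠ 0) :
    Omega q κ l = gF q * gE q + κ ^ 2 •
      ((q • gK q - (q⁻¹ * l⁻¹) • gK' q) * ((1 : ℂ) • gK q - l • gK' q)) := by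
  have hκq : κ ^ 2 * (q - q⁻¹) ^ 2 = 1 := by
    rw [hκ, ← neg_sub q⁻¹ q, neg_sq, ← mul_pow, inv_mul_cancel₀ hq, one_pow]
  have hEF : gE q * gF q = gF q * gE q +
      (κ ^ 2 * (q - q⁻¹)) • (gK q * gK q - gK' q * gK' q) := by
    rw [← smul_commutator_gE_gF, smul_smul, mul_assoc, ← sq, hκq, one_smul]
    abel
  rw [Omega_eq, linear_mul_linear, linear_mul_linear, hEF]
  match_scalars <;> field_simp <;> ring

theorem Omega_commute_gE {q κ l : ℂ} (hq : q⁻¹ - q ≠ 0) (hκ : κ = (q⁻¹ - q)⁻¹)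
    (hq0 : q ≠ 0) (hl : l ≠ 0) : Commute (Omega q κ l) (gE q) := by
  change Omega q κ l * gE q = gE q * Omega q κ l
  nth_rw 2 [Omega_eq_gF_mul_gE hq hκ hq0 hl]
  rw [Omega_eq, add_mul, mul_add, mul_assoc, smul_mul_assoc, mul_assoc, linear_mul_gE,
    ← mul_assoc _ (gE q), linear_mul_gE, mul_smul_comm, mul_assoc (gE q) _ (_ - _),
    linear_mul_linear, linear_mul_linear]
  congr 3
  match_scalars <;> field_simp <;> ring

theorem Omega_commute_gF {q κ l : ℂ} (hq : q⁻¹ - q ≠ 0) (hκ : κ = (q⁻¹ - q)⁻¹)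
    (hq0 : q ≠ 0) (hl : l ≠ 0) : Commute (Omega q κ l) (gF q) := by
  change Omega q κ l * gF q = gF q * Omega q κ l
  nth_rw 1 [Omega_eq_gF_mul_gE hq hκ hq0 hl]
  rw [Omega_eq, add_mul, mul_add, mul_assoc, smul_mul_assoc, mul_assoc, linear_mul_gF,
    ← mul_assoc _ (gF q), linear_mul_gF, mul_smul_comm, mul_assoc (gF q) _ (_ - _),
    linear_mul_linear, linear_mul_linear]
  congr 3
  match_scalars <;> field_simp <;> ring

theorem Omega_commute_gK {q : ℂ} (κ l : ℂ) (hq0 : q ≠ 0) : Commute (Omega q κ l) (gK q) := by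
  rw [Omega_eq]
  exact (commute_mul_of_smul (gK_mul_gE q) (gK_mul_gF q) (inv_mul_cancel₀ hq0)).add_left
    (((commute_gK_linear q _ _).mul_left (commute_gK_linear q _ _)).smul_left _)

theorem Omega_commute_gK' {q : ℂ} (κ l : ℂ) (hq0 : q ≠ 0) : Commute (Omega q κ l) (gK' q) := by
  rw [Omega_eq]
  exact (commute_mul_of_smul (gK'_mul_gE q) (gK'_mul_gF q) (mul_inv_cancel₀ hq0)).add_left
    (((commute_gK'_linear q _ _).mul_left (commute_gK'_linear q _ _)).smul_left _)

theorem gK_mul_gK'_mem_center {q : ℂ} (hq0 : q ≠ 0) :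
    gK q * gK' q ∈ Subalgebra.center ℂ (SAlg q) := by
  have hKK' : Commute (gK q) (gK' q) := gK_mul_gK' q
  refine mem_center_of_commute_generators ?_ ?_ ((Commute.refl _).mul_left hKK'.symm)
    (hKK'.mul_left (Commute.refl _))
  · change gK q * gK' q * gE q = gE q * (gK q * gK' q)
    rw [mul_assoc, gK'_mul_gE, mul_smul_comm, ← mul_assoc, gK_mul_gE, smul_mul_assoc, smul_smul,
      inv_mul_cancel₀ hq0, one_smul, mul_assoc]
  · change gK q * gK' q * gF q = gF q * (gK q * gK' q)
    rw [mul_assoc, gK'_mul_gF, mul_smul_comm, ← mul_assoc, gK_mul_gF, smul_mul_assoc, smul_smul,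
      mul_inv_cancel₀ hq0, one_smul, mul_assoc]

theorem stmt_1 (q : ℂ) (hq0 : q ≠ 0) (hq1 : q ≠ 1) (hqm1 : q ≠ -1)
    (κ : ℂ) (hκ : κ = (q⁻¹ - q)⁻¹) (l : ℂ) (hl : l ≠ 0) :
    -- (i)
    Omega q κ l
      = gF q * gE q + κ ^ 2 • ((q • gK q - (q⁻¹ * l⁻¹) • gK' q) * (gK q - l • gK' q))
    -- (ii)
    ∧ Commute (Omega q κ l) (gE q)
    ∧ Commute (Omega q κ l) (gF q)
    ∧ Commute (Omega q κ l) (gK q)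
    ∧ Commute (Omega q κ l) (gK' q)
    ∧ Omega q κ l ∈ Subalgebra.center ℂ (SAlg q)
    -- (iii)
    ∧ gK q * gK' q ∈ Subalgebra.center ℂ (SAlg q) := by
  have hq : q⁻¹ - q ≠ 0 := by
    intro h
    have hsq : q * q = 1 := by
      nth_rw 2 [← sub_eq_zero.mp h]
      exact mul_inv_cancel₀ hq0
    exact (mul_self_eq_one_iff.mp hsq).elim hq1 hqm1
  have hE := Omega_commute_gE hq hκ hq0 hl
  have hF := Omega_commute_gF hq hκ hq0 hl
  have hK := Omega_commute_gK κ l hq0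
  have hK' := Omega_commute_gK' κ l hq0
  refine ⟨?_, hE, hF, hK, hK', mem_center_of_commute_generators hE hF hK hK',
    gK_mul_gK'_mem_center hq0⟩
  rw [Omega_eq_gF_mul_gE hq hκ hq0 hl, one_smul]
end
end

section
/- The subset {(e, f, k, k′) ∈ ℂ⁴ : fk = 0, ek = 0, and ef = κ²(k² − k′²)} of ℂ⁴ equals cone(C′) ∪ {(0,0,t,t) : t ∈ ℂ} ∪ {(0,0,t,−t) : t ∈ ℂ}. -/
noncomputable section

/-- The subset `{(e,f,k,k′) ∈ ℂ⁴ : fk = 0, ek = 0, ef = κ²(k² − k′²)}` of `ℂ⁴` equals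
`cone(C′) ∪ {(0,0,t,t)} ∪ {(0,0,t,−t)}`, where
`cone(C′) = {(e,f,k,k′) : k = 0, ef + κ²k′² = 0}`.
Coordinates: `v 0 = e`, `v 1 = f`, `v 2 = k`, `v 3 = k′`. -/
theorem stmt_4 (q κ : ℂ) (hq0 : q ≠ 0) (hq1 : q ≠ 1) (hqm1 : q ≠ -1)
    (hκ : κ = (q⁻¹ - q)⁻¹) :
    {v : Fin 4 → ℂ | v 1 * v 2 = 0 ∧ v 0 * v 2 = 0 ∧
        v 0 * v 1 = κ ^ 2 * ((v 2) ^ 2 - (v 3) ^ 2)}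
      = {v : Fin 4 → ℂ | v 2 = 0 ∧ v 0 * v 1 + κ ^ 2 * (v 3) ^ 2 = 0}
        ∪ {v : Fin 4 → ℂ | ∃ t : ℂ, v = ![0, 0, t, t]}
        ∪ {v : Fin 4 → ℂ | ∃ t : ℂ, v = ![0, 0, t, -t]} := by
  have hκ0 : κ ≠ 0 := by
    rw [hκ]
    refine inv_ne_zero fun h => ?_
    have hsq : q ^ 2 = 1 := by
      field_simp at h
      linear_combination -h
    exact (eq_or_eq_neg_of_sq_eq_sq q 1 (by rw [hsq, one_pow])).elim hq1 hqm1
  ext v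
  simp only [Set.mem_union, Set.mem_ofPred_eq]
  constructor
  · rintro ⟨hfk, hek, hef⟩
    by_cases hk : v 2 = 0
    · refine Or.inl (Or.inl ⟨hk, ?_⟩)
      rw [hef, hk]
      ring
    · have hf : v 1 = 0 := (mul_eq_zero.mp hfk).resolve_right hk
      have he : v 0 = 0 := (mul_eq_zero.mp hek).resolve_right hk
      have hsq : v 3 ^ 2 = v 2 ^ 2 := by
        rw [he, zero_mul, eq_comm, mul_eq_zero] at hef
        exact (sub_eq_zero.mp (hef.resolve_left (pow_ne_zero 2 hκ0))).symm
      rcases sq_eq_sq_iff_eq_or_eq_neg.mp hsq with h | h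
      · refine Or.inl (Or.inr ⟨v 2, ?_⟩)
        ext i
        fin_cases i <;> simp [he, hf, h]
      · refine Or.inr ⟨v 2, ?_⟩
        ext i
        fin_cases i <;> simp [he, hf, h]
  · rintro ((⟨hk, h⟩ | ⟨t, rfl⟩) | ⟨t, rfl⟩)
    · refine ⟨by simp [hk], by simp [hk], ?_⟩
      rw [hk]
      linear_combination h
    · simp
    · simp
end
end

section
/- Assume in addition that q is not a root of unity. Let ζ = (ζ_e, ζ_f, ζ_k, ζ_{k′}) ∈ ℂ⁴ ∖ {0}, let ζ^⊥ be the 3-dimensional subspace {aE + bF + cK + dK′ ∈ S₁ : aζ_e + bζ_f + cζ_k + dζ_{k′} = 0} of the degree-1 component S₁ of S, and let M = S/Sζ^⊥ with its induced grading. Then dim_ℂ M_n = 1 for every n ≥ 0 (i.e., M is a point module) if and only if ζ ∈ cone(C) ∪ cone(C′) ∪ {v ∈ ℂ⁴ : v_k = v_{k′} = 0} ∪ ℂ·(0,0,1,1) ∪ ℂ·(0,0,1,−1). (Thus the point scheme of S is the union of the two conics C and C′, the line K = K′ = 0, and the two points (0,0,1,±1).) -/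
noncomputable section

open FreeAlgebra

/-- The degree-1 component `S₁` of `S`, spanned by the generators. -/
def S1 (q : ℂ) : Submodule ℂ (SAlg q) :=
  Submodule.span ℂ {gE q, gF q, gK q, gK' q}

/-- The left ideal `S·ζ^⊥`, where `ζ^⊥ = {aE + bF + cK + dK′ : aζ₀ + bζ₁ + cζ₂ + dζ₃ = 0}`
is the codimension-one subspace of `S₁` of linear forms vanishing at `ζ`. -/
def perpIdeal (q : ℂ) (ζ : Fin 4 → ℂ) : Submodule (SAlg q) (SAlg q) :=
  Submodule.span (SAlg q)
    {x : SAlg q | ∃ a b c d : ℂ,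
      a * ζ 0 + b * ζ 1 + c * ζ 2 + d * ζ 3 = 0 ∧
      x = a • gE q + b • gF q + c • gK q + d • gK' q}

/-- The generators of `S`, indexed by `Fin 4` in the order `E, F, K, K′`. -/
def gen (q : ℂ) (j : Fin 4) : SAlg q := RingQuot.mkAlgHom ℂ (SRel q) (ι ℂ j)

lemma S1_eq_span_range_gen (q : ℂ) : S1 q = Submodule.span ℂ (Set.range (gen q)) := by
  unfold S1
  congr 1
  ext x
  simp only [Set.mem_insert_iff, Set.mem_singleton_iff, Set.mem_range, Fin.exists_fin_succ]
  simp [gen, gE, gF, gK, gK', eq_comm]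

lemma gen_mem_S1 (q : ℂ) (j : Fin 4) : gen q j ∈ S1 q := by
  rw [S1_eq_span_range_gen]
  exact Submodule.subset_span ⟨j, rfl⟩

/-- The system obtained from the defining relations of `S` when the right-hand factors take the
scalar values `ζ` and the left-hand factors take the vector values `X`. -/
structure Incident (q : ℂ) {M : Type} [AddCommGroup M] [Module ℂ M]
    (X : Fin 4 → M) (ζ : Fin 4 → ℂ) : Prop where
  KE : ζ 0 • X 2 = (q * ζ 2) • X 0
  KF : ζ 1 • X 2 = (q⁻¹ * ζ 2) • X 1
  KK' : ζ 3 • X 2 = ζ 2 • X 3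
  K'E : ζ 0 • X 3 = (q⁻¹ * ζ 3) • X 0
  K'F : ζ 1 • X 3 = (q * ζ 3) • X 1
  EF : (q - q⁻¹) • (ζ 1 • X 0 - ζ 0 • X 1) = ζ 2 • X 2 - ζ 3 • X 3

lemma gen_KE (q : ℂ) : gen q 2 * gen q 0 = q • (gen q 0 * gen q 2) := by
  simpa [gen] using RingQuot.mkAlgHom_rel ℂ (SRel.KE (q := q))

lemma gen_KF (q : ℂ) : gen q 2 * gen q 1 = q⁻¹ • (gen q 1 * gen q 2) := by
  simpa [gen] using RingQuot.mkAlgHom_rel ℂ (SRel.KF (q := q))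

lemma gen_KK' (q : ℂ) : gen q 2 * gen q 3 = gen q 3 * gen q 2 := by
  simpa [gen] using RingQuot.mkAlgHom_rel ℂ (SRel.KK' (q := q))

lemma gen_K'E (q : ℂ) : gen q 3 * gen q 0 = q⁻¹ • (gen q 0 * gen q 3) := by
  simpa [gen] using RingQuot.mkAlgHom_rel ℂ (SRel.K'E (q := q))

lemma gen_K'F (q : ℂ) : gen q 3 * gen q 1 = q • (gen q 1 * gen q 3) := by
  simpa [gen] using RingQuot.mkAlgHom_rel ℂ (SRel.K'F (q := q))

lemma gen_EF (q : ℂ) : (q - q⁻¹) • (gen q 0 * gen q 1 - gen q 1 * gen q 0) =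
    gen q 2 * gen q 2 - gen q 3 * gen q 3 := by
  have h := RingQuot.mkAlgHom_rel ℂ (SRel.EF (q := q))
  simp only [map_smul, map_sub, map_mul] at h
  exact h

/-- In an `S`-module, if every generator sends `m` into `ℂ · m'` with coefficients `ζ`, then the
images of `m'` under the generators are incident to `ζ`. -/
lemma incident_of_gen_smul {q : ℂ} {M : Type} [AddCommGroup M] [Module ℂ M] [Module (SAlg q) M]
    [IsScalarTower ℂ (SAlg q) M] [SMulCommClass ℂ (SAlg q) M] {m m' : M} {ζ : Fin 4 → ℂ}
    (h : ∀ j, gen q j • m = ζ j • m') : Incident q (fun j => gen q j • m') ζ := by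
  have key (i j : Fin 4) : (gen q i * gen q j) • m = ζ j • gen q i • m' := by
    rw [mul_smul, h, smul_comm]
  constructor
  · simpa only [smul_assoc, key, mul_smul] using congrArg (· • m) (gen_KE q)
  · simpa only [smul_assoc, key, mul_smul] using congrArg (· • m) (gen_KF q)
  · simpa only [key] using congrArg (· • m) (gen_KK' q)
  · simpa only [smul_assoc, key, mul_smul] using congrArg (· • m) (gen_K'E q)
  · simpa only [smul_assoc, key, mul_smul] using congrArg (· • m) (gen_K'F q)
  · simpa only [smul_assoc, key, sub_smul (R := SAlg q)] using congrArg (· • m) (gen_EF q)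

lemma Incident.of_smul {q : ℂ} {M : Type} [AddCommGroup M] [Module ℂ M] {w : M} (hw : w ≠ 0)
    {η ζ : Fin 4 → ℂ} (h : Incident q (fun j => η j • w) ζ) : Incident q η ζ := by
  obtain ⟨h1, h2, h3, h4, h5, h6⟩ := h
  simp only [smul_smul, ← sub_smul] at h1 h2 h3 h4 h5 h6
  have inj := smul_left_injective ℂ hw
  exact ⟨inj h1, inj h2, inj h3, inj h4, inj h5, inj h6⟩

/-- The union of the two conics, the line and the two points, as a subset of `ℂ⁴`, split
according to the vanishing of the coordinates `k` and `k′`. -/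
def PointLocus (q : ℂ) (ζ : Fin 4 → ℂ) : Prop :=
  (ζ 2 ≠ 0 ∧ ζ 0 * ζ 3 = 0 ∧ ζ 1 * ζ 3 = 0 ∧ (q⁻¹ - q) ^ 2 * (ζ 0 * ζ 1) + ζ 2 ^ 2 = ζ 3 ^ 2)
    ∨ (ζ 2 = 0 ∧ ζ 3 ≠ 0 ∧ (q⁻¹ - q) ^ 2 * (ζ 0 * ζ 1) + ζ 3 ^ 2 = 0)
    ∨ (ζ 2 = 0 ∧ ζ 3 = 0)

lemma pointLocus_iff {q κ : ℂ} (hq : q⁻¹ - q ≠ 0) (hκ : κ = (q⁻¹ - q)⁻¹) (ζ : Fin 4 → ℂ) :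
    PointLocus q ζ ↔
      ((ζ 3 = 0 ∧ ζ 0 * ζ 1 + κ ^ 2 * (ζ 2) ^ 2 = 0)
      ∨ (ζ 2 = 0 ∧ ζ 0 * ζ 1 + κ ^ 2 * (ζ 3) ^ 2 = 0)
      ∨ (ζ 2 = 0 ∧ ζ 3 = 0)
      ∨ (∃ t : ℂ, ζ = ![0, 0, t, t])
      ∨ (∃ t : ℂ, ζ = ![0, 0, t, -t])) := by
  have conic (x : ℂ) : ζ 0 * ζ 1 + κ ^ 2 * x ^ 2 = 0 ↔
      (q⁻¹ - q) ^ 2 * (ζ 0 * ζ 1) + x ^ 2 = 0 := by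
    have hκ' : (q⁻¹ - q) * κ = 1 := by rw [hκ, mul_inv_cancel₀ hq]
    rw [← mul_right_inj' (pow_ne_zero 2 hq), mul_zero, mul_add, ← mul_assoc _ (κ ^ 2), ← mul_pow,
      hκ', one_pow, one_mul]
  rw [conic, conic]
  constructor
  · rintro (⟨hk, h0, h1, h⟩ | ⟨hk, -, h⟩ | h)
    · by_cases hl : ζ 3 = 0
      · exact Or.inl ⟨hl, by simpa [hl] using h⟩
      · have h0' : ζ 0 = 0 := by simpa [hl] using h0
        have h1' : ζ 1 = 0 := by simpa [hl] using h1
        have hkl : ζ 3 ^ 2 = ζ 2 ^ 2 := by simpa [h0'] using h.symm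
        rcases sq_eq_sq_iff_eq_or_eq_neg.1 hkl with h | h
        · refine Or.inr (Or.inr (Or.inr (Or.inl ⟨ζ 2, ?_⟩)))
          ext j; fin_cases j <;> simp [h0', h1', h]
        · refine Or.inr (Or.inr (Or.inr (Or.inr ⟨ζ 2, ?_⟩)))
          ext j; fin_cases j <;> simp [h0', h1', h]
    · exact Or.inr (Or.inl ⟨hk, h⟩)
    · exact Or.inr (Or.inr (Or.inl h))
  · unfold PointLocus
    rintro (⟨hl, h⟩ | ⟨hk, h⟩ | h | ⟨t, rfl⟩ | ⟨t, rfl⟩)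
    · by_cases hk : ζ 2 = 0
      · exact Or.inr (Or.inr ⟨hk, hl⟩)
      · exact Or.inl ⟨hk, by simp [hl], by simp [hl], by simpa [hl] using h⟩
    · by_cases hl : ζ 3 = 0
      · exact Or.inr (Or.inr ⟨hk, hl⟩)
      · exact Or.inr (Or.inl ⟨hk, hl, h⟩)
    · exact Or.inr (Or.inr h)
    · by_cases ht : t = 0 <;> simp [ht]
    · by_cases ht : t = 0 <;> simp [ht]

lemma Incident.pointLocus {q : ℂ} (hq0 : q ≠ 0) (hq2 : q ^ 2 ≠ 1) {η ζ : Fin 4 → ℂ} (hη : η ≠ 0)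
    (h : Incident q η ζ) : PointLocus q ζ := by
  obtain ⟨h1, h2, h3, h4, h5, h6⟩ := h
  simp only [smul_eq_mul] at h1 h2 h3 h4 h5 h6
  have hq : q * q⁻¹ = 1 := mul_inv_cancel₀ hq0
  have hq2' : q ^ 2 - 1 ≠ 0 := sub_ne_zero.2 hq2
  unfold PointLocus
  by_cases hk : ζ 2 = 0
  · by_cases hl : ζ 3 = 0
    · exact Or.inr (Or.inr ⟨hk, hl⟩)
    · refine Or.inr (Or.inl ⟨hk, hl, ?_⟩)
      simp only [hk, mul_zero, zero_mul] at h1 h2 h3 h6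
      have hX2 : η 2 = 0 := by simpa [hl] using h3
      have hX3 : η 3 ≠ 0 := by
        intro h0
        apply hη
        have hX0 : η 0 = 0 := by simpa [h0, hq0, hl] using h4
        have hX1 : η 1 = 0 := by simpa [h0, hq0, hl] using h5
        ext j; fin_cases j <;> simp [hX0, hX1, hX2, h0]
      have hE : ζ 3 * η 0 = q * ζ 0 * η 3 := by linear_combination -q * h4 - ζ 3 * η 0 * hq
      have hF : ζ 3 * η 1 = q⁻¹ * ζ 1 * η 3 := by linear_combination -q⁻¹ * h5 - ζ 3 * η 1 * hq
      apply mul_left_cancel₀ hX3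
      linear_combination ζ 3 * h6 - (q - q⁻¹) * ζ 1 * hE + (q - q⁻¹) * ζ 0 * hF
  · have hE : ζ 2 * η 0 = q⁻¹ * ζ 0 * η 2 := by linear_combination -q⁻¹ * h1 - ζ 2 * η 0 * hq
    have hF : ζ 2 * η 1 = q * ζ 1 * η 2 := by linear_combination -q * h2 - ζ 2 * η 1 * hq
    have hX2 : η 2 ≠ 0 := by
      intro h0
      apply hη
      have hX0 : η 0 = 0 := by simpa [h0, hk] using hE
      have hX1 : η 1 = 0 := by simpa [h0, hk] using hF
      have hX3 : η 3 = 0 := by simpa [h0, hk] using h3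
      ext j; fin_cases j <;> simp [hX0, hX1, hX3, h0]
    refine Or.inl ⟨hk, ?_, ?_, ?_⟩
    · apply mul_left_cancel₀ (mul_ne_zero hX2 hq2')
      linear_combination q ^ 2 * (ζ 2 * h4 + ζ 0 * h3 + q⁻¹ * ζ 3 * hE)
        + ζ 0 * ζ 3 * η 2 * (q * q⁻¹ + 1) * hq
    · apply mul_left_cancel₀ (mul_ne_zero hX2 hq2')
      linear_combination -(ζ 2 * h5 + ζ 1 * h3 + q * ζ 3 * hF)
    · apply mul_left_cancel₀ hX2
      linear_combination -ζ 2 * h6 + (q - q⁻¹) * ζ 1 * hE - (q - q⁻¹) * ζ 0 * hF - ζ 3 * h3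

/-- A nonzero point of the locus determines a unique next point of the locus. -/
lemma PointLocus.exists_next {q : ℂ} (hq0 : q ≠ 0) (hq : q - q⁻¹ ≠ 0) {ζ : Fin 4 → ℂ}
    (hζ : ζ ≠ 0) (h : PointLocus q ζ) :
    ∃ η : Fin 4 → ℂ, (η ≠ 0 ∧ PointLocus q η) ∧ Incident q η ζ ∧
      ∀ (M : Type) [AddCommGroup M] [Module ℂ M] (X : Fin 4 → M),
        Incident q X ζ → ∃ w, ∀ j, X j = η j • w := by
  have hqq : q * q⁻¹ = 1 := mul_inv_cancel₀ hq0
  have cancel {M : Type} [AddCommGroup M] [Module ℂ M] {c d : ℂ} (hc : c ≠ 0) {x y : M}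
      (hxy : d • y = c • x) : x = d • c⁻¹ • y := by
    rw [smul_comm, hxy, inv_smul_smul₀ hc]
  rcases h with ⟨hk, h0, h1, h⟩ | ⟨hk, hl, h⟩ | ⟨hk, hl⟩
  · refine ⟨![q⁻¹ * ζ 0, q * ζ 1, ζ 2, ζ 3], ⟨fun h => hk ?_, Or.inl ⟨hk, ?_, ?_, ?_⟩⟩,
      ⟨?_, ?_, ?_, ?_, ?_, ?_⟩, fun M _ _ X hX => ⟨(ζ 2)⁻¹ • X 2, ?_⟩⟩
    · simpa using congrFun h 2
    · simpa [hq0] using h0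
    · simpa [hq0] using h1
    · simp; linear_combination h + (q⁻¹ - q) ^ 2 * (ζ 0 * ζ 1) * hqq
    · simp; linear_combination -ζ 0 * ζ 2 * hqq
    · simp; linear_combination -ζ 1 * ζ 2 * hqq
    · simp; ring
    · simp; linear_combination (1 - q⁻¹ ^ 2) * h0
    · simp; linear_combination (1 - q ^ 2) * h1
    · simp; linear_combination -h
    · have hE : X 0 = (q⁻¹ * ζ 0) • (ζ 2)⁻¹ • X 2 := cancel hk <| by
        rw [mul_smul, hX.KE, smul_smul]
        congr 1; linear_combination ζ 2 * hqq
      have hF : X 1 = (q * ζ 1) • (ζ 2)⁻¹ • X 2 := cancel hk <| by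
        rw [mul_smul, hX.KF, smul_smul]
        congr 1; linear_combination ζ 2 * hqq
      have hL : X 3 = ζ 3 • (ζ 2)⁻¹ • X 2 := cancel hk hX.KK'
      intro j
      fin_cases j
      · exact hE
      · exact hF
      · exact (smul_inv_smul₀ hk _).symm
      · exact hL
  · refine ⟨![q * ζ 0, q⁻¹ * ζ 1, 0, ζ 3], ⟨fun h => hl ?_, Or.inr (Or.inl ⟨rfl, hl, ?_⟩)⟩,
      ⟨?_, ?_, ?_, ?_, ?_, ?_⟩, fun M _ _ X hX => ⟨(ζ 3)⁻¹ • X 3, ?_⟩⟩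
    · simpa using congrFun h 3
    · simp; linear_combination h + (q⁻¹ - q) ^ 2 * (ζ 0 * ζ 1) * hqq
    · simp [hk]
    · simp [hk]
    · simp [hk]
    · simp; linear_combination -ζ 0 * ζ 3 * hqq
    · simp; linear_combination -ζ 1 * ζ 3 * hqq
    · simp; linear_combination h
    · have hE : X 0 = (q * ζ 0) • (ζ 3)⁻¹ • X 3 := cancel hl <| by
        rw [mul_smul, hX.K'E, smul_smul]
        congr 1; linear_combination ζ 3 * hqq
      have hF : X 1 = (q⁻¹ * ζ 1) • (ζ 3)⁻¹ • X 3 := cancel hl <| by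
        rw [mul_smul, hX.K'F, smul_smul]
        congr 1; linear_combination ζ 3 * hqq
      have hK : X 2 = 0 := by simpa [hk, hl] using hX.KK'
      intro j
      fin_cases j
      · exact hE
      · exact hF
      · simpa using hK
      · exact (smul_inv_smul₀ hl _).symm
  · have hef : ζ 0 ≠ 0 ∨ ζ 1 ≠ 0 := by
      by_contra! hc
      apply hζ
      ext j; fin_cases j <;> simp [hk, hl, hc.1, hc.2]
    refine ⟨ζ, ⟨hζ, Or.inr (Or.inr ⟨hk, hl⟩)⟩,
      ⟨by simp [hk], by simp [hk], by simp [hk, hl], by simp [hl], by simp [hl],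
        by simp [hk, hl, mul_comm]⟩, fun M _ _ X hX => ?_⟩
    have hEF : ζ 1 • X 0 = ζ 0 • X 1 := by
      simpa [hk, hl, hq, sub_eq_zero] using hX.EF
    have hK : X 2 = 0 := by
      rcases hef with h | h
      · simpa [hk, h] using hX.KE
      · simpa [hk, h] using hX.KF
    have hL : X 3 = 0 := by
      rcases hef with h | h
      · simpa [hl, h] using hX.K'E
      · simpa [hl, h] using hX.K'F
    rcases hef with h | h
    · refine ⟨(ζ 0)⁻¹ • X 0, fun j => ?_⟩
      fin_cases j
      · exact (smul_inv_smul₀ h _).symm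
      · exact cancel h hEF
      · simpa [hk] using hK
      · simpa [hl] using hL
    · refine ⟨(ζ 1)⁻¹ • X 1, fun j => ?_⟩
      fin_cases j
      · exact cancel h hEF.symm
      · exact (smul_inv_smul₀ h _).symm
      · simpa [hk] using hK
      · simpa [hl] using hL

/-- The operator on `⊕ₙ ℂ mₙ` sending `mₙ` to `cₙ mₙ₊₁`. -/
def weightedShift (c : ℕ → ℂ) : Module.End ℂ (ℕ →₀ ℂ) :=
  Finsupp.linearCombination ℂ fun n => Finsupp.single (n + 1) (c n)

lemma weightedShift_single (c : ℕ → ℂ) (n : ℕ) (a : ℂ) :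
    weightedShift c (Finsupp.single n a) = Finsupp.single (n + 1) (a * c n) := by
  simp [weightedShift]

/-- The graded module `⊕ₙ ℂ mₙ` attached to a sequence of successively incident points. -/
lemma exists_weightedShift_rep {q : ℂ} {z : ℕ → Fin 4 → ℂ}
    (hz : ∀ n, Incident q (z (n + 1)) (z n)) :
    ∃ ρ : SAlg q →ₐ[ℂ] Module.End ℂ (ℕ →₀ ℂ),
      ∀ j, ρ (gen q j) = weightedShift fun n => z n j := by
  refine ⟨RingQuot.liftAlgHom ℂ
    ⟨FreeAlgebra.lift ℂ fun j => weightedShift fun n => z n j, ?_⟩, fun j =>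
      (RingQuot.liftAlgHom_mkAlgHom_apply _ _ _ _).trans (FreeAlgebra.lift_ι_apply _ _)⟩
  intro x y hxy
  ext n : 2
  obtain ⟨h1, h2, h3, h4, h5, h6⟩ := hz n
  simp only [smul_eq_mul] at h1 h2 h3 h4 h5 h6
  cases hxy
  all_goals
    simp only [map_mul, map_smul, map_sub, FreeAlgebra.lift_ι_apply, LinearMap.comp_apply,
      Finsupp.lsingle_apply, LinearMap.smul_apply, LinearMap.sub_apply, Module.End.mul_apply,
      weightedShift_single, Finsupp.smul_single, ← Finsupp.single_sub, smul_eq_mul, one_mul]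
    refine congrArg (Finsupp.single _) ?_
    first
    | linear_combination h1
    | linear_combination h2
    | linear_combination h3
    | linear_combination h4
    | linear_combination h5
    | linear_combination h6

lemma smul_mem_span_of_mem_S1 {q : ℂ} {M : Type} [AddCommGroup M] [Module ℂ M]
    [Module (SAlg q) M] [IsScalarTower ℂ (SAlg q) M] {m m' : M}
    (h : ∀ j, gen q j • m ∈ Submodule.span ℂ {m'}) {x : SAlg q} (hx : x ∈ S1 q) :
    x • m ∈ Submodule.span ℂ {m'} := by
  rw [S1_eq_span_range_gen] at hx
  induction hx using Submodule.span_induction with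
  | mem x hx => obtain ⟨j, rfl⟩ := hx; exact h j
  | zero => simp
  | add x y _ _ hx hy => rw [add_smul]; exact add_mem hx hy
  | smul c x _ hx => rw [smul_assoc]; exact Submodule.smul_mem _ c hx

lemma smul_mem_span_of_mem_S1_pow {q : ℂ} {M : Type} [AddCommGroup M] [Module ℂ M]
    [Module (SAlg q) M] [IsScalarTower ℂ (SAlg q) M] [SMulCommClass ℂ (SAlg q) M] {m : ℕ → M}
    (h : ∀ n j, gen q j • m n ∈ Submodule.span ℂ {m (n + 1)}) (n : ℕ) {x : SAlg q}
    (hx : x ∈ S1 q ^ n) : x • m 0 ∈ Submodule.span ℂ {m n} := by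
  induction n generalizing x with
  | zero =>
    obtain ⟨c, rfl⟩ := Submodule.mem_one.1 (by simpa using hx)
    rw [algebraMap_smul]
    exact Submodule.smul_mem _ c (Submodule.mem_span_singleton_self _)
  | succ n ih =>
    rw [pow_succ'] at hx
    induction hx using Submodule.mul_induction_on' with
    | mem_mul_mem x hx y hy =>
      obtain ⟨c, hc⟩ := Submodule.mem_span_singleton.1 (ih hy)
      rw [mul_smul, ← hc, ← smul_comm c x]
      exact Submodule.smul_mem _ c (smul_mem_span_of_mem_S1 (h n) hx)
    | add x _ y _ hx hy => rw [add_smul]; exact add_mem hx hy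

lemma mkQ_eq_smul {q : ℂ} (I : Submodule (SAlg q) (SAlg q)) (x : SAlg q) :
    I.mkQ x = x • I.mkQ 1 := by
  rw [← map_smul, smul_eq_mul, mul_one]

lemma smul_gen_sub_mem_perpIdeal (q : ℂ) (ζ : Fin 4 → ℂ) (i j : Fin 4) :
    ζ i • gen q j - ζ j • gen q i ∈ perpIdeal q ζ := by
  apply Submodule.subset_span
  refine ⟨(Pi.single j (ζ i) - Pi.single i (ζ j) : Fin 4 → ℂ) 0,
    (Pi.single j (ζ i) - Pi.single i (ζ j) : Fin 4 → ℂ) 1,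
    (Pi.single j (ζ i) - Pi.single i (ζ j) : Fin 4 → ℂ) 2,
    (Pi.single j (ζ i) - Pi.single i (ζ j) : Fin 4 → ℂ) 3, ?_, ?_⟩
  · fin_cases i <;> fin_cases j <;> simp <;> ring
  · change _ = _ • gen q 0 + _ • gen q 1 + _ • gen q 2 + _ • gen q 3
    fin_cases i <;> fin_cases j <;> simp <;> module

lemma exists_gen_smul_mkQ_one (q : ℂ) {ζ : Fin 4 → ℂ} (hζ : ζ ≠ 0) :
    ∃ m : SAlg q ⧸ perpIdeal q ζ, ∀ j, gen q j • (perpIdeal q ζ).mkQ 1 = ζ j • m := by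
  obtain ⟨i, hi⟩ := Function.ne_iff.1 hζ
  refine ⟨(ζ i)⁻¹ • (perpIdeal q ζ).mkQ (gen q i), fun j => ?_⟩
  have h := (Submodule.Quotient.eq _).2 (smul_gen_sub_mem_perpIdeal q ζ i j)
  rw [← mkQ_eq_smul, smul_comm]
  exact (eq_inv_smul_iff₀ (α := ℂ) (β := SAlg q ⧸ perpIdeal q ζ) hi).2 h

/-- If `ρ` is a representation in which `ζ^⊥` kills `v`, then so does the left ideal `S·ζ^⊥`. -/
lemma apply_eq_zero_of_mem_perpIdeal {q : ℂ} {V : Type} [AddCommGroup V] [Module ℂ V]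
    (ρ : SAlg q →ₐ[ℂ] Module.End ℂ V) {ζ : Fin 4 → ℂ} {v w : V}
    (h : ∀ j, ρ (gen q j) v = ζ j • w) {x : SAlg q} (hx : x ∈ perpIdeal q ζ) : ρ x v = 0 := by
  induction hx using Submodule.span_induction with
  | mem x hx =>
    obtain ⟨a, b, c, d, habcd, rfl⟩ := hx
    change ρ (a • gen q 0 + b • gen q 1 + c • gen q 2 + d • gen q 3) v = 0
    simp only [map_add, map_smul, LinearMap.add_apply, LinearMap.smul_apply, h, smul_smul,
      ← add_smul, habcd, zero_smul]
  | zero => simp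
  | add x y _ _ hx hy => simp [hx, hy]
  | smul a x _ hx => simp [hx]

/-- Each graded component of `S/Sζ^⊥` contains a nonzero element when `ζ` starts a sequence of
nonzero, successively incident points. -/
lemma exists_mem_S1_pow_notMem_perpIdeal {q : ℂ} {z : ℕ → Fin 4 → ℂ} (hz0 : ∀ n, z n ≠ 0)
    (hz : ∀ n, Incident q (z (n + 1)) (z n)) (n : ℕ) :
    ∃ x ∈ S1 q ^ n, x ∉ perpIdeal q (z 0) := by
  obtain ⟨ρ, hρ⟩ := exists_weightedShift_rep hz
  have key : ∃ x ∈ S1 q ^ n, ∃ c : ℂ, c ≠ 0 ∧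
      ρ x (Finsupp.single 0 1) = Finsupp.single n c := by
    induction n with
    | zero => exact ⟨1, pow_zero (S1 q) ▸ Submodule.one_le.1 le_rfl, 1, one_ne_zero, by simp⟩
    | succ n ih =>
      obtain ⟨x, hx, c, hc, hxc⟩ := ih
      obtain ⟨j, hj⟩ := Function.ne_iff.1 (hz0 n)
      refine ⟨gen q j * x, ?_, c * z n j, mul_ne_zero hc hj, ?_⟩
      · rw [pow_succ']
        exact Submodule.mul_mem_mul (gen_mem_S1 q j) hx
      · rw [map_mul, Module.End.mul_apply, hxc, hρ, weightedShift_single]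
  obtain ⟨x, hx, c, hc, hxc⟩ := key
  refine ⟨x, hx, fun hmem => hc ?_⟩
  have h0 := apply_eq_zero_of_mem_perpIdeal ρ (v := Finsupp.single 0 1)
    (w := Finsupp.single 1 1) (fun j => by simp [hρ, weightedShift_single]) hmem
  simpa [hxc] using h0

lemma PointLocus.finrank_eq_one {q : ℂ} (hq0 : q ≠ 0) (hq : q - q⁻¹ ≠ 0) {ζ : Fin 4 → ℂ}
    (hζ : ζ ≠ 0) (h : PointLocus q ζ) (n : ℕ) :
    Module.finrank ℂ ↥(Submodule.map
      (((perpIdeal q ζ).mkQ).restrictScalars ℂ) (S1 q ^ n)) = 1 := by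
  choose! next hnext hinc huniq using
    fun ζ : Fin 4 → ℂ => fun hζ : ζ ≠ 0 ∧ PointLocus q ζ =>
      PointLocus.exists_next hq0 hq hζ.1 hζ.2
  let z : ℕ → Fin 4 → ℂ := fun n => next^[n] ζ
  have hzs (n : ℕ) : z (n + 1) = next (z n) := Function.iterate_succ_apply' _ _ _
  have hz (n : ℕ) : z n ≠ 0 ∧ PointLocus q (z n) := by
    induction n with
    | zero => exact ⟨hζ, h⟩
    | succ n ih => rw [hzs]; exact hnext _ ih
  obtain ⟨m₁, hm₁⟩ := exists_gen_smul_mkQ_one q hζ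
  let M := SAlg q ⧸ perpIdeal q ζ
  have step (n : ℕ) (p : M × M) (hp : ∀ j, gen q j • p.1 = z n j • p.2) :
      ∃ w : M, ∀ j, gen q j • p.2 = z (n + 1) j • w := by
    rw [hzs]
    exact huniq _ (hz n) M _ (incident_of_gen_smul hp)
  choose! w hw using step
  let p : ℕ → M × M := fun n => Nat.rec ((perpIdeal q ζ).mkQ 1, m₁) (fun n p => (p.2, w n p)) n
  have hp (n : ℕ) : ∀ j, gen q j • (p n).1 = z n j • (p (n + 1)).1 := by
    induction n with
    | zero => exact hm₁
    | succ n ih => exact hw n (p n) ih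
  have hle : Submodule.map (((perpIdeal q ζ).mkQ).restrictScalars ℂ) (S1 q ^ n) ≤
      Submodule.span ℂ {(p n).1} := by
    rintro _ ⟨x, hx, rfl⟩
    rw [LinearMap.restrictScalars_apply, mkQ_eq_smul]
    refine smul_mem_span_of_mem_S1_pow (m := fun n => (p n).1) (fun n j => ?_) n hx
    rw [hp]
    exact Submodule.smul_mem _ _ (Submodule.mem_span_singleton_self _)
  obtain ⟨x, hx, hxI⟩ := exists_mem_S1_pow_notMem_perpIdeal (fun n => (hz n).1)
    (fun n => (hzs n).symm ▸ hinc _ (hz n)) n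
  refine le_antisymm ((Submodule.finrank_mono hle).trans ?_) ?_
  · exact (finrank_span_le_card _).trans (by simp)
  · have : FiniteDimensional ℂ ↥(Submodule.map
        (((perpIdeal q ζ).mkQ).restrictScalars ℂ) (S1 q ^ n)) :=
      Submodule.finiteDimensional_of_le hle
    rw [Submodule.one_le_finrank_iff]
    refine (Submodule.ne_bot_iff _).2 ⟨_, Submodule.mem_map_of_mem hx, fun h0 => hxI ?_⟩
    exact (Submodule.Quotient.mk_eq_zero _).1 h0

lemma pointLocus_of_finrank_eq_one {q : ℂ} (hq0 : q ≠ 0) (hq2 : q ^ 2 ≠ 1) {ζ : Fin 4 → ℂ}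
    (hζ : ζ ≠ 0)
    (h : Module.finrank ℂ ↥(Submodule.map
      (((perpIdeal q ζ).mkQ).restrictScalars ℂ) (S1 q ^ 2)) = 1) : PointLocus q ζ := by
  obtain ⟨m₁, hm₁⟩ := exists_gen_smul_mkQ_one q hζ
  have hmem (i : Fin 4) : gen q i • m₁ ∈ Submodule.map
      (((perpIdeal q ζ).mkQ).restrictScalars ℂ) (S1 q ^ 2) := by
    obtain ⟨j, hj⟩ := Function.ne_iff.1 hζ
    refine (Submodule.smul_mem_iff _ hj).1 ?_
    rw [smul_comm, ← hm₁, smul_smul, ← mkQ_eq_smul, pow_two]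
    exact Submodule.mem_map_of_mem (Submodule.mul_mem_mul (gen_mem_S1 q i) (gen_mem_S1 q j))
  obtain ⟨v, hv, hspan⟩ := finrank_eq_one_iff'.1 h
  choose η hη using fun i => hspan ⟨_, hmem i⟩
  have hη' : (fun i => gen q i • m₁) = fun i => η i • v.1 :=
    funext fun i => (congrArg Subtype.val (hη i)).symm
  have hinc := incident_of_gen_smul (M := SAlg q ⧸ perpIdeal q ζ) hm₁
  rw [hη'] at hinc
  refine Incident.pointLocus hq0 hq2 (fun h0 => hv ?_)
    (hinc.of_smul fun h0 => hv (Subtype.ext h0))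
  obtain ⟨x, hx, hxv⟩ := v.2
  let m : ℕ → SAlg q ⧸ perpIdeal q ζ := fun n =>
    Nat.casesOn n ((perpIdeal q ζ).mkQ 1) fun n => Nat.casesOn n m₁ 0
  have hm (n : ℕ) (j : Fin 4) : gen q j • m n ∈ Submodule.span ℂ {m (n + 1)} := by
    match n with
    | 0 => exact hm₁ j ▸ Submodule.smul_mem _ _ (Submodule.mem_span_singleton_self _)
    | 1 =>
      have hj : gen q j • m₁ = 0 := (congrFun hη' j).trans (by rw [h0]; exact zero_smul ℂ v.1)
      change gen q j • m₁ ∈ _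
      rw [hj]
      exact zero_mem _
    | n + 2 => simp [m]
  have hx0 : x • (perpIdeal q ζ).mkQ 1 ∈ Submodule.span ℂ {0} :=
    smul_mem_span_of_mem_S1_pow hm 2 hx
  rw [LinearMap.restrictScalars_apply, mkQ_eq_smul] at hxv
  exact Subtype.ext (hxv.symm.trans (by simpa using hx0))

/-- `M = S/Sζ^⊥` is a point module (its degree-`n` component, the image of the span of
the length-`n` words in the generators, is 1-dimensional for all `n ≥ 0`) iff `ζ` lies on
`cone(C) ∪ cone(C′) ∪ {k = k′ = 0} ∪ ℂ·(0,0,1,1) ∪ ℂ·(0,0,1,−1)`: the point scheme of `S`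
is the union of the two conics `C`, `C′`, the line `K = K′ = 0` and the points
`(0,0,1,±1)`. Coordinates on `S₁* = ℂ⁴`: `ζ 0 = e`, `ζ 1 = f`, `ζ 2 = k`, `ζ 3 = k′`. -/
theorem stmt_5 (q : ℂ) (hq0 : q ≠ 0) (hroot : ∀ m : ℕ, 0 < m → q ^ m ≠ 1)
    (κ : ℂ) (hκ : κ = (q⁻¹ - q)⁻¹) (ζ : Fin 4 → ℂ) (hζ : ζ ≠ 0) :
    (∀ n : ℕ,
      Module.finrank ℂ
        ↥(Submodule.map
            (((perpIdeal q ζ).mkQ).restrictScalars ℂ) (S1 q ^ n)) = 1)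
    ↔ ((ζ 3 = 0 ∧ ζ 0 * ζ 1 + κ ^ 2 * (ζ 2) ^ 2 = 0)
      ∨ (ζ 2 = 0 ∧ ζ 0 * ζ 1 + κ ^ 2 * (ζ 3) ^ 2 = 0)
      ∨ (ζ 2 = 0 ∧ ζ 3 = 0)
      ∨ (∃ t : ℂ, ζ = ![0, 0, t, t])
      ∨ (∃ t : ℂ, ζ = ![0, 0, t, -t])) := by
  have hq2 : q ^ 2 ≠ 1 := hroot 2 two_pos
  have hq : q - q⁻¹ ≠ 0 := fun h => hq2 <| by
    linear_combination q * h + mul_inv_cancel₀ hq0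
  rw [← pointLocus_iff (by rwa [← neg_sub, neg_ne_zero]) hκ]
  exact ⟨fun h => pointLocus_of_finrank_eq_one hq0 hq2 hζ (h 2),
    fun h => h.finrank_eq_one hq0 hq hζ⟩
end
end

section
/- Assume in addition that q is not a root of unity. Let L ⊆ ℂ⁴ be a 2-dimensional subspace, let ℓ^⊥ be the 2-dimensional subspace {aE + bF + cK + dK′ ∈ S₁ : aζ_e + bζ_f + cζ_k + dζ_{k′} = 0 for all ζ ∈ L} of S₁, and let M = S/Sℓ^⊥ with its induced grading. Then dim_ℂ M_n = n + 1 for every n ≥ 0 (i.e., M is a line module) if and only if either there exists λ ∈ ℂ ∖ {0} such that g_λ vanishes identically on L, or the quadratic form kk′ vanishes identically on L. (Equivalently: the line ℙ(L) ⊆ ℙ³ lies on one of the quadrics Q(λ) of the pencil, where Q(0) = Q(∞) = {kk′ = 0}.) -/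
noncomputable section

open FreeAlgebra

/-- The left ideal `S·ℓ^⊥`, where
`ℓ^⊥ = {aE + bF + cK + dK′ : aζ₀ + bζ₁ + cζ₂ + dζ₃ = 0 for all ζ ∈ L}` is the subspace of
`S₁` of linear forms vanishing on `L`. -/
def linePerpIdeal (q : ℂ) (L : Submodule ℂ (Fin 4 → ℂ)) : Submodule (SAlg q) (SAlg q) :=
  Submodule.span (SAlg q)
    {x : SAlg q | ∃ a b c d : ℂ,
      (∀ ζ ∈ L, a * ζ 0 + b * ζ 1 + c * ζ 2 + d * ζ 3 = 0) ∧
      x = a • gE q + b • gF q + c • gK q + d • gK' q}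

/-- The defining relations of `S`, for a quadruple `x = (E, F, K, K′)` in a `ℂ`-algebra. -/
structure IsSRep {A : Type} [Ring A] [Algebra ℂ A] (q : ℂ) (x : Fin 4 → A) : Prop where
  KE : x 2 * x 0 = q • (x 0 * x 2)
  KF : x 2 * x 1 = q⁻¹ • (x 1 * x 2)
  KK' : x 2 * x 3 = x 3 * x 2
  K'E : x 3 * x 0 = q⁻¹ • (x 0 * x 3)
  K'F : x 3 * x 1 = q • (x 1 * x 3)
  EF : (q - q⁻¹) • (x 0 * x 1 - x 1 * x 0) = x 2 * x 2 - x 3 * x 3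

section Symmetry

variable {A : Type} [Ring A] [Algebra ℂ A] {q : ℂ} {x : Fin 4 → A}

lemma IsSRep.swapEF (h : IsSRep q x) : IsSRep q⁻¹ (x ∘ Equiv.swap 0 1) := by
  have e0 : (Equiv.swap 0 1 : Equiv.Perm (Fin 4)) 0 = 1 := by decide
  have e1 : (Equiv.swap 0 1 : Equiv.Perm (Fin 4)) 1 = 0 := by decide
  have e2 : (Equiv.swap 0 1 : Equiv.Perm (Fin 4)) 2 = 2 := by decide
  have e3 : (Equiv.swap 0 1 : Equiv.Perm (Fin 4)) 3 = 3 := by decide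
  constructor <;> simp only [Function.comp_apply, e0, e1, e2, e3, inv_inv]
  · exact h.KF
  · exact h.KE
  · exact h.KK'
  · exact h.K'F
  · exact h.K'E
  · rw [← h.EF]; module

lemma IsSRep.swapKK' (h : IsSRep q x) : IsSRep q⁻¹ (x ∘ Equiv.swap 2 3) := by
  have e0 : (Equiv.swap 2 3 : Equiv.Perm (Fin 4)) 0 = 0 := by decide
  have e1 : (Equiv.swap 2 3 : Equiv.Perm (Fin 4)) 1 = 1 := by decide
  have e2 : (Equiv.swap 2 3 : Equiv.Perm (Fin 4)) 2 = 3 := by decide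
  have e3 : (Equiv.swap 2 3 : Equiv.Perm (Fin 4)) 3 = 2 := by decide
  constructor <;> simp only [Function.comp_apply, e0, e1, e2, e3, inv_inv]
  · exact h.K'E
  · exact h.K'F
  · exact h.KK'.symm
  · exact h.KE
  · exact h.KF
  · rw [← neg_sub (x 2 * x 2), ← h.EF]; module

end Symmetry

/-- The span of the images of `m` under the words of length `n` in the operators `x`. -/
def wordSpan {V : Type} [AddCommGroup V] [Module ℂ V] (x : Fin 4 → Module.End ℂ V) (m : V) :
    ℕ → Submodule ℂ V
  | 0 => Submodule.span ℂ {m}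
  | n + 1 => ⨆ i, (wordSpan x m n).map (x i)

section WordSpan

variable {V : Type} [AddCommGroup V] [Module ℂ V] {x : Fin 4 → Module.End ℂ V} {m : V}

lemma wordSpan_comp_perm (σ : Equiv.Perm (Fin 4)) (n : ℕ) :
    wordSpan (x ∘ σ) m n = wordSpan x m n := by
  induction n with
  | zero => rfl
  | succ n ih =>
    simp only [wordSpan, ih, Function.comp_apply]
    exact σ.iSup_comp (g := fun i => (wordSpan x m n).map (x i))

lemma apply_mem_wordSpan (i : Fin 4) {n : ℕ} {w : V} (hw : w ∈ wordSpan x m n) :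
    x i w ∈ wordSpan x m (n + 1) :=
  Submodule.mem_iSup_of_mem (p := fun i => (wordSpan x m n).map (x i)) i
    (Submodule.mem_map_of_mem hw)

lemma pow_apply_mem_wordSpan (i : Fin 4) (n : ℕ) : (x i ^ n) m ∈ wordSpan x m n := by
  induction n with
  | zero => exact Submodule.mem_span_singleton_self m
  | succ n ih => rw [pow_succ', Module.End.mul_apply]; exact apply_mem_wordSpan i ih

instance wordSpan_finite (n : ℕ) : Module.Finite ℂ (wordSpan x m n) := by
  induction n with
  | zero => exact inferInstanceAs (Module.Finite ℂ (Submodule.span ℂ {m}))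
  | succ n ih =>
    exact inferInstanceAs (Module.Finite ℂ ↥(⨆ i, (wordSpan x m n).map (x i)))

/-- The part of `wordSpan x m (n + 1)` obtained by applying `x a` to words of length `n`,
together with `(x b) ^ (n + 1) m`. -/
def leadSpan (x : Fin 4 → Module.End ℂ V) (m : V) (a b : Fin 4) (n : ℕ) : Submodule ℂ V :=
  (wordSpan x m n).map (x a) ⊔ Submodule.span ℂ {(x b ^ (n + 1)) m}

instance leadSpan_finite (a b : Fin 4) (n : ℕ) : Module.Finite ℂ (leadSpan x m a b n) :=
  inferInstanceAs (Module.Finite ℂ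
    ↥((wordSpan x m n).map (x a) ⊔ Submodule.span ℂ {(x b ^ (n + 1)) m}))

lemma apply_mem_leadSpan {a b : Fin 4} {n : ℕ} {w : V} (hw : w ∈ wordSpan x m n) :
    x a w ∈ leadSpan x m a b n :=
  Submodule.mem_sup_left (Submodule.mem_map_of_mem hw)

lemma pow_mem_leadSpan {a b : Fin 4} {n : ℕ} : (x b ^ (n + 1)) m ∈ leadSpan x m a b n :=
  Submodule.mem_sup_right (Submodule.mem_span_singleton_self _)

lemma map_le_of_leadSpan {a b c : Fin 4} {n : ℕ} {T : Submodule ℂ V}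
    (h : wordSpan x m (n + 1) ≤ leadSpan x m a b n)
    (ha : ∀ w ∈ wordSpan x m n, x c (x a w) ∈ T) (hb : x c ((x b ^ (n + 1)) m) ∈ T) :
    ∀ w ∈ wordSpan x m (n + 1), x c w ∈ T := by
  intro w hw
  obtain ⟨y, hy, z, hz, rfl⟩ := Submodule.mem_sup.1 (h hw)
  obtain ⟨y', hy', rfl⟩ := hy
  obtain ⟨t, rfl⟩ := Submodule.mem_span_singleton.1 hz
  rw [map_add, map_smul]
  exact T.add_mem (ha _ hy') (T.smul_mem _ hb)

lemma wordSpan_succ_le {n : ℕ} {T : Submodule ℂ V}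
    (h : ∀ c, ∀ w ∈ wordSpan x m n, x c w ∈ T) : wordSpan x m (n + 1) ≤ T :=
  iSup_le fun c => Submodule.map_le_iff_le_comap.2 fun w hw => h c w hw

lemma finrank_wordSpan_le {a b : Fin 4}
    (h : ∀ n, wordSpan x m (n + 1) ≤ leadSpan x m a b n) (n : ℕ) :
    Module.finrank ℂ (wordSpan x m n) ≤ n + 1 := by
  induction n with
  | zero => exact (finrank_span_le_card _).trans (by simp)
  | succ n ih =>
    refine (Submodule.finrank_mono (h n)).trans ?_
    refine (Submodule.finrank_add_le_finrank_add_finrank _ _).trans ?_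
    have h1 := Submodule.finrank_map_le (x a) (wordSpan x m n)
    have h2 : Module.finrank ℂ (Submodule.span ℂ {(x b ^ (n + 1)) m}) ≤ 1 :=
      (finrank_span_le_card _).trans (by simp)
    omega

lemma apply_pow_apply_of_mul_eq {X Y : Module.End ℂ V} {t : ℂ} (h : X * Y = t • (Y * X))
    (n : ℕ) (w : V) : X ((Y ^ n) w) = t ^ n • (Y ^ n) (X w) := by
  induction n generalizing w with
  | zero => simp
  | succ n ih =>
    have h' : X (Y w) = t • Y (X w) := by simpa using congr($h w)
    rw [pow_succ Y, Module.End.mul_apply, ih, h', map_smul, smul_smul, ← pow_succ]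
    rfl

lemma apply_pow_mem_leadSpan {a b c : Fin 4} {n : ℕ} {t r α β : ℂ}
    (hcb : x c * x b = t • (x b * x c)) (hab : x a * x b = r • (x b * x a)) (hr : r ≠ 0)
    (hm : x c m = α • x a m + β • x b m) : x c ((x b ^ n) m) ∈ leadSpan x m a b n := by
  rw [apply_pow_apply_of_mul_eq hcb, hm, map_add, map_smul, map_smul]
  refine Submodule.smul_mem _ _ (Submodule.add_mem _ (Submodule.smul_mem _ _ ?_)
    (Submodule.smul_mem _ _ ?_))
  · have h : (x b ^ n) (x a m) = (r ^ n)⁻¹ • x a ((x b ^ n) m) := by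
      rw [apply_pow_apply_of_mul_eq hab, smul_smul, inv_mul_cancel₀ (pow_ne_zero _ hr), one_smul]
    rw [h]
    exact Submodule.smul_mem _ _ (apply_mem_leadSpan (pow_apply_mem_wordSpan _ _))
  · rw [← Module.End.mul_apply, ← pow_succ]
    exact pow_mem_leadSpan

lemma apply_apply_mem_leadSpan {a b c : Fin 4} {n : ℕ} {s : ℂ}
    (hca : x c * x a = s • (x a * x c)) {w : V} (hw : w ∈ wordSpan x m n) :
    x c (x a w) ∈ leadSpan x m a b (n + 1) := by
  have : x c (x a w) = s • x a (x c w) := by simpa using congr($hca w)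
  rw [this]
  exact Submodule.smul_mem _ _ (apply_mem_leadSpan (apply_mem_wordSpan _ hw))

lemma wordSpan_one_le {a b : Fin 4} {u v : Fin 4 → ℂ}
    (hm : ∀ c, x c m = u c • x a m + v c • x b m) :
    wordSpan x m 1 ≤ leadSpan x m a b 0 := by
  refine wordSpan_succ_le fun c w hw => ?_
  obtain ⟨t, rfl⟩ := Submodule.mem_span_singleton.1 hw
  rw [map_smul, hm]
  refine Submodule.smul_mem _ _ (Submodule.add_mem _ (Submodule.smul_mem _ _ ?_)
      (Submodule.smul_mem _ _ ?_))
  · exact apply_mem_leadSpan (Submodule.mem_span_singleton_self m)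
  · simpa using pow_mem_leadSpan (x := x) (m := m) (a := a) (b := b) (n := 0)

end WordSpan

section UpperBounds

variable {V : Type} [AddCommGroup V] [Module ℂ V] {q : ℂ} {x : Fin 4 → Module.End ℂ V} {m : V}

lemma IsSRep.apply_E_F (h : IsSRep q x) (hs : q - q⁻¹ ≠ 0) (w : V) :
    x 0 (x 1 w) = x 1 (x 0 w) + (q - q⁻¹)⁻¹ • (x 2 (x 2 w) - x 3 (x 3 w)) := by
  have h1 := congr($(h.EF) w)
  simp only [LinearMap.smul_apply, LinearMap.sub_apply, Module.End.mul_apply] at h1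
  rw [← h1, smul_smul, inv_mul_cancel₀ hs, one_smul]
  abel

lemma IsSRep.finrank_wordSpan_le_of_KK' (h : IsSRep q x) (hq : q ≠ 0) {u v : Fin 4 → ℂ}
    (hm : ∀ c, x c m = u c • x 2 m + v c • x 3 m) (n : ℕ) :
    Module.finrank ℂ (wordSpan x m n) ≤ n + 1 := by
  have hE2 : x 0 * x 2 = q⁻¹ • (x 2 * x 0) := by
    rw [h.KE, smul_smul, inv_mul_cancel₀ hq, one_smul]
  have hF2 : x 1 * x 2 = q • (x 2 * x 1) := by
    rw [h.KF, smul_smul, mul_inv_cancel₀ hq, one_smul]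
  have hE3 : x 0 * x 3 = q • (x 3 * x 0) := by
    rw [h.K'E, smul_smul, mul_inv_cancel₀ hq, one_smul]
  have hF3 : x 1 * x 3 = q⁻¹ • (x 3 * x 1) := by
    rw [h.K'F, smul_smul, inv_mul_cancel₀ hq, one_smul]
  have h23 : x 2 * x 3 = (1 : ℂ) • (x 3 * x 2) := by rw [h.KK', one_smul]
  have h32 : x 3 * x 2 = (1 : ℂ) • (x 2 * x 3) := by rw [h.KK', one_smul]
  have hself : ∀ c, x c * x c = (1 : ℂ) • (x c * x c) := fun c => (one_smul _ _).symm
  refine finrank_wordSpan_le (a := 2) (b := 3) (fun n => ?_) n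
  induction n with
  | zero => exact wordSpan_one_le hm
  | succ n ih =>
    refine wordSpan_succ_le fun c => map_le_of_leadSpan ih (fun w hw => ?_) ?_
    · fin_cases c
      exacts [apply_apply_mem_leadSpan hE2 hw, apply_apply_mem_leadSpan hF2 hw,
        apply_apply_mem_leadSpan (hself 2) hw, apply_apply_mem_leadSpan h32 hw]
    · fin_cases c
      exacts [apply_pow_mem_leadSpan hE3 h23 one_ne_zero (hm 0),
        apply_pow_mem_leadSpan hF3 h23 one_ne_zero (hm 1),
        apply_pow_mem_leadSpan h23 h23 one_ne_zero (hm 2),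
        apply_pow_mem_leadSpan (hself 3) h23 one_ne_zero (hm 3)]

lemma IsSRep.finrank_wordSpan_le_of_FK' (h : IsSRep q x) (hq : q ≠ 0) (hs : q - q⁻¹ ≠ 0)
    {u v : Fin 4 → ℂ} (hm : ∀ c, x c m = u c • x 1 m + v c • x 3 m) (n : ℕ) :
    Module.finrank ℂ (wordSpan x m n) ≤ n + 1 := by
  have hE3 : x 0 * x 3 = q • (x 3 * x 0) := by
    rw [h.K'E, smul_smul, mul_inv_cancel₀ hq, one_smul]
  have hF3 : x 1 * x 3 = q⁻¹ • (x 3 * x 1) := by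
    rw [h.K'F, smul_smul, inv_mul_cancel₀ hq, one_smul]
  have h23 : x 2 * x 3 = (1 : ℂ) • (x 3 * x 2) := by rw [h.KK', one_smul]
  have hself : ∀ c, x c * x c = (1 : ℂ) • (x c * x c) := fun c => (one_smul _ _).symm
  have hq' := inv_ne_zero hq
  refine finrank_wordSpan_le (a := 1) (b := 3) (fun n => ?_) n
  induction n with
  | zero => exact wordSpan_one_le hm
  | succ n ih =>
    have hK : ∀ w ∈ wordSpan x m (n + 1), x 2 w ∈ leadSpan x m 1 3 (n + 1) :=
      map_le_of_leadSpan ih (fun w hw => apply_apply_mem_leadSpan h.KF hw)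
        (apply_pow_mem_leadSpan h23 hF3 hq' (hm 2))
    have hK' : ∀ w ∈ wordSpan x m (n + 1), x 3 w ∈ leadSpan x m 1 3 (n + 1) :=
      map_le_of_leadSpan ih (fun w hw => apply_apply_mem_leadSpan h.K'F hw)
        (apply_pow_mem_leadSpan (hself 3) hF3 hq' (hm 3))
    have hE : ∀ w ∈ wordSpan x m (n + 1), x 0 w ∈ leadSpan x m 1 3 (n + 1) := by
      refine map_le_of_leadSpan ih (fun w hw => ?_)
        (apply_pow_mem_leadSpan hE3 hF3 hq' (hm 0))
      rw [h.apply_E_F hs]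
      exact add_mem (apply_mem_leadSpan (apply_mem_wordSpan 0 hw)) (Submodule.smul_mem _ _
        (sub_mem (hK _ (apply_mem_wordSpan 2 hw)) (hK' _ (apply_mem_wordSpan 3 hw))))
    refine wordSpan_succ_le fun c => ?_
    fin_cases c
    exacts [hE, fun w hw => apply_mem_leadSpan hw, hK, hK']

lemma IsSRep.finrank_wordSpan_le_of_EF (h : IsSRep q x) (hs : q - q⁻¹ ≠ 0)
    (hK : x 2 m = 0) (hK' : x 3 m = 0) (n : ℕ) :
    Module.finrank ℂ (wordSpan x m n) ≤ n + 1 := by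
  refine finrank_wordSpan_le (a := 0) (b := 1) (fun n => ?_) n
  induction n with
  | zero =>
    refine wordSpan_one_le (u := ![1, 0, 0, 0]) (v := ![0, 1, 0, 0]) fun c => ?_
    fin_cases c <;> simp [hK, hK']
  | succ n ih =>
    have h2 : ∀ w ∈ wordSpan x m (n + 1), x 2 w ∈ leadSpan x m 0 1 (n + 1) := by
      refine map_le_of_leadSpan ih (fun w hw => apply_apply_mem_leadSpan h.KE hw) ?_
      simp [apply_pow_apply_of_mul_eq h.KF, hK]
    have h3 : ∀ w ∈ wordSpan x m (n + 1), x 3 w ∈ leadSpan x m 0 1 (n + 1) := by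
      refine map_le_of_leadSpan ih (fun w hw => apply_apply_mem_leadSpan h.K'E hw) ?_
      simp [apply_pow_apply_of_mul_eq h.K'F, hK']
    have h1 : ∀ w ∈ wordSpan x m (n + 1), x 1 w ∈ leadSpan x m 0 1 (n + 1) := by
      refine map_le_of_leadSpan ih (fun w hw => ?_) ?_
      · rw [← sub_eq_of_eq_add (h.apply_E_F hs w)]
        exact sub_mem (apply_mem_leadSpan (apply_mem_wordSpan 1 hw)) (Submodule.smul_mem _ _
          (sub_mem (h2 _ (apply_mem_wordSpan 2 hw)) (h3 _ (apply_mem_wordSpan 3 hw))))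
      · rw [← Module.End.mul_apply, ← pow_succ']
        exact pow_mem_leadSpan
    refine wordSpan_succ_le fun c => ?_
    fin_cases c
    exacts [fun w hw => apply_mem_leadSpan hw, h1, h2, h3]

end UpperBounds

/-- The vector space with basis `ℕ × ℕ`, on which the models of line modules live. -/
abbrev GridSpace : Type := ℕ × ℕ →₀ ℂ

/-- The basis vector of `GridSpace` at `(i, j)`. -/
def grid (i j : ℕ) : GridSpace := Finsupp.single (i, j) 1

/-- The endomorphism of `GridSpace` with prescribed values on the basis. -/
def gridEnd (φ : ℕ → ℕ → GridSpace) : Module.End ℂ GridSpace :=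
  Finsupp.linearCombination ℂ fun p : ℕ × ℕ => φ p.1 p.2

@[simp] lemma gridEnd_grid (φ : ℕ → ℕ → GridSpace) (i j : ℕ) : gridEnd φ (grid i j) = φ i j := by
  simp [gridEnd, grid]

lemma gridEnd_ext {X Y : Module.End ℂ GridSpace} (h : ∀ i j, X (grid i j) = Y (grid i j)) :
    X = Y :=
  Finsupp.lhom_ext' fun p => LinearMap.ext_ring (h p.1 p.2)

/-- `u` and `v` span a line for which there is a model of the line module on `GridSpace`, and for
which the words of length `n` in any representation span a space of dimension at most `n + 1`. -/
structure IsModelled (q : ℂ) (u v : Fin 4 → ℂ) : Prop where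
  model : ∃ X : Fin 4 → Module.End ℂ GridSpace, IsSRep q X ∧
    (∀ c, X c (grid 0 0) = u c • grid 1 0 + v c • grid 0 1) ∧
    ∃ a b, (∀ i j, X a (grid i j) = grid (i + 1) j) ∧ ∀ j, X b (grid 0 j) = grid 0 (j + 1)
  upper : ∀ (V : Type) [AddCommGroup V] [Module ℂ V] (x : Fin 4 → Module.End ℂ V) (m : V),
    IsSRep q x → (∀ w : Fin 4 → ℂ, ∑ i, w i * u i = 0 → ∑ i, w i * v i = 0 →
      ∑ i, w i • x i m = 0) → ∀ n, Module.finrank ℂ (wordSpan x m n) ≤ n + 1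

lemma IsModelled.comp_perm {q q' : ℂ} {u v : Fin 4 → ℂ} (σ : Equiv.Perm (Fin 4))
    (hσ : ∀ {V : Type} [AddCommGroup V] [Module ℂ V] (x : Fin 4 → Module.End ℂ V),
      IsSRep q x → IsSRep q' (x ∘ σ))
    (hσ' : ∀ {V : Type} [AddCommGroup V] [Module ℂ V] (x : Fin 4 → Module.End ℂ V),
      IsSRep q' x → IsSRep q (x ∘ σ.symm))
    (h : IsModelled q u v) : IsModelled q' (u ∘ σ) (v ∘ σ) where
  model := by
    obtain ⟨X, hX, h1, a, b, ha, hb⟩ := h.model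
    exact ⟨X ∘ σ, hσ X hX, fun c => h1 _, σ.symm a, σ.symm b, by simpa using ha, by simpa using hb⟩
  upper V _ _ x m hx hm n := by
    rw [← wordSpan_comp_perm σ.symm]
    refine h.upper V _ m (hσ' x hx) (fun w hu hv => ?_) n
    have := hm (w ∘ σ) ?_ ?_
    · rw [← Equiv.sum_comp σ]
      simpa using this
    · simpa using (Equiv.sum_comp σ fun i => w i * u i).trans hu
    · simpa using (Equiv.sum_comp σ fun i => w i * v i).trans hv

lemma IsModelled.swapEF {q : ℂ} {u v : Fin 4 → ℂ} (h : IsModelled q⁻¹ u v) :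
    IsModelled q (u ∘ Equiv.swap 0 1) (v ∘ Equiv.swap 0 1) :=
  h.comp_perm _ (fun x hx => by simpa using hx.swapEF) (fun x hx => by simpa using hx.swapEF)

lemma IsModelled.swapKK' {q : ℂ} {u v : Fin 4 → ℂ} (h : IsModelled q⁻¹ u v) :
    IsModelled q (u ∘ Equiv.swap 2 3) (v ∘ Equiv.swap 2 3) :=
  h.comp_perm _ (fun x hx => by simpa using hx.swapKK') (fun x hx => by simpa using hx.swapKK')

lemma apply_eq_of_annihilator {V : Type} [AddCommGroup V] [Module ℂ V]
    {x : Fin 4 → Module.End ℂ V} {m : V} {u v : Fin 4 → ℂ} {a b : Fin 4}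
    (hua : u a = 1) (hub : u b = 0) (hva : v a = 0) (hvb : v b = 1)
    (h : ∀ w : Fin 4 → ℂ, ∑ i, w i * u i = 0 → ∑ i, w i * v i = 0 → ∑ i, w i • x i m = 0)
    (c : Fin 4) : x c m = u c • x a m + v c • x b m := by
  have := h (Pi.single c 1 - u c • Pi.single a 1 - v c • Pi.single b 1) ?_ ?_
  · simp only [Pi.sub_apply, Pi.smul_apply, smul_eq_mul, sub_smul, Finset.sum_sub_distrib,
      Pi.single_apply, mul_ite, mul_one, mul_zero, ite_smul, zero_smul, one_smul,
      Finset.sum_ite_eq', Finset.mem_univ, if_true] at this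
    rw [sub_sub, sub_eq_zero] at this
    exact this
  · simp [sub_mul, Finset.sum_sub_distrib, Pi.single_apply, hua, hub]
  · simp [sub_mul, Finset.sum_sub_distrib, Pi.single_apply, hva, hvb]

lemma isModelled_KK' {q : ℂ} (hq : q ≠ 0) {α β γ δ : ℂ}
    (hαγ : (q - q⁻¹) ^ 2 * (α * γ) = -1) (hβδ : (q - q⁻¹) ^ 2 * (β * δ) = -1) :
    IsModelled q ![α, γ, 1, 0] ![β, δ, 0, 1] where
  model := by
    refine ⟨![
      gridEnd fun i j => (q ^ j * q⁻¹ ^ i) • (α • grid (i + 1) j + β • grid i (j + 1)),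
      gridEnd fun i j => (q ^ i * q⁻¹ ^ j) • (γ • grid (i + 1) j + δ • grid i (j + 1)),
      gridEnd fun i j => grid (i + 1) j, gridEnd fun i j => grid i (j + 1)], ?_, ?_, 2, 3, ?_, ?_⟩
    · constructor <;> refine gridEnd_ext fun i j => ?_ <;> simp
      · match_scalars <;> field_simp <;> ring
      · match_scalars <;> field_simp <;> ring
      · match_scalars <;> field_simp <;> ring
      · match_scalars <;> field_simp <;> ring
      · match_scalars
        · field_simp
          field_simp at hαγ
          linear_combination -q ^ (2 * i) * hαγ
        · field_simp
          ring
        · field_simp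
          field_simp at hβδ
          linear_combination q ^ (2 * j) * hβδ
    · intro c; fin_cases c <;> simp
    · simp
    · simp
  upper V _ _ x m hx hm n :=
    hx.finrank_wordSpan_le_of_KK' hq (apply_eq_of_annihilator rfl rfl rfl rfl hm) n

lemma isModelled_FK' {q : ℂ} (hq : q ≠ 0) (hs : q - q⁻¹ ≠ 0) {β γ c : ℂ}
    (h : c = 0 ∨ β = 0 ∧ γ = 0) : IsModelled q ![β, 1, 0, 0] ![γ, 0, c, 1] where
  model := by
    let ε : ℕ → ℂ := fun i => ∑ t ∈ Finset.range i, (c ^ 2 * q⁻¹ ^ (2 * t) - q ^ (2 * t)) / (q - q⁻¹)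
    have hε0 : ε 0 = 0 := rfl
    have hε : ∀ i, (q - q⁻¹) * ε (i + 1) =
        (q - q⁻¹) * ε i + (c ^ 2 * q⁻¹ ^ (2 * i) - q ^ (2 * i)) := fun i => by
      simp only [ε, Finset.sum_range_succ]
      rw [mul_add, mul_div_cancel₀ _ hs]
    clear_value ε
    refine ⟨![
      gridEnd fun i j => (β * q ^ (2 * j)) • grid (i + 1) j + (γ * q ^ j) • grid i (j + 1) +
        ε i • grid (i - 1) (j + 2),
      gridEnd fun i j => grid (i + 1) j, gridEnd fun i j => (c * q⁻¹ ^ i) • grid i (j + 1),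
      gridEnd fun i j => q ^ i • grid i (j + 1)], ?_, ?_, 1, 3, ?_, ?_⟩
    · constructor <;> refine gridEnd_ext fun i j => ?_ <;> simp
      · rcases h with rfl | ⟨rfl, rfl⟩
        · simp
        · cases i with
          | zero => simp [hε0]
          | succ i => simp; match_scalars; field_simp; ring
      · match_scalars; field_simp; ring
      · match_scalars; field_simp
      · cases i with
          | zero => simp [hε0]; match_scalars <;> field_simp <;> ring
          | succ i => simp; match_scalars <;> field_simp <;> ring
      · match_scalars; field_simp; ring
      · cases i with
          | zero =>
            have := hε 0
            simp [hε0] at this ⊢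
            match_scalars
            linear_combination this
          | succ i =>
            have := hε (i + 1)
            simp at this ⊢
            match_scalars
            field_simp
            field_simp at this
            linear_combination this
    · intro c; fin_cases c <;> simp [hε0]
    · simp
    · simp
  upper V _ _ x m hx hm n :=
    hx.finrank_wordSpan_le_of_FK' hq hs (apply_eq_of_annihilator rfl rfl rfl rfl hm) n

lemma isModelled_EF {q : ℂ} (hs : q - q⁻¹ ≠ 0) : IsModelled q ![1, 0, 0, 0] ![0, 1, 0, 0] where
  model := by
    refine ⟨![gridEnd fun i j => grid (i + 1) j, gridEnd fun i j => grid i (j + 1), 0, 0],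
      ?_, ?_, 0, 1, ?_, ?_⟩
    · constructor <;> refine gridEnd_ext fun i j => ?_ <;> simp
    · intro c; fin_cases c <;> simp
    · simp
    · simp
  upper V _ _ x m hx hm n := by
    have := apply_eq_of_annihilator (a := 0) (b := 1) rfl rfl rfl rfl hm
    exact hx.finrank_wordSpan_le_of_EF hs (by simpa using this 2) (by simpa using this 3) n

/-- The four generators of `S`. -/
def gens (q : ℂ) : Fin 4 → SAlg q := ![gE q, gF q, gK q, gK' q]

lemma gens_eq (q : ℂ) (i : Fin 4) : gens q i = RingQuot.mkAlgHom ℂ (SRel q) (ι ℂ i) := by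
  fin_cases i <;> rfl

lemma isSRep_gens (q : ℂ) : IsSRep q (gens q) := by
  constructor <;> simp only [gens_eq, ← map_mul, ← map_smul, ← map_sub] <;>
    apply RingQuot.mkAlgHom_rel
  exacts [.KE, .KF, .KK', .K'E, .K'F, .EF]

lemma IsSRep.map {A B : Type} [Ring A] [Algebra ℂ A] [Ring B] [Algebra ℂ B] {q : ℂ}
    {x : Fin 4 → A} (h : IsSRep q x) (φ : A →ₐ[ℂ] B) : IsSRep q fun i => φ (x i) := by
  constructor <;> simp only [← map_mul, ← map_smul, ← map_sub]
  exacts [congr(φ $h.KE), congr(φ $h.KF), congr(φ $h.KK'), congr(φ $h.K'E), congr(φ $h.K'F),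
    congr(φ $h.EF)]

lemma IsSRep.exists_algHom {A : Type} [Ring A] [Algebra ℂ A] {q : ℂ} {x : Fin 4 → A}
    (h : IsSRep q x) : ∃ φ : SAlg q →ₐ[ℂ] A, ∀ i, φ (gens q i) = x i := by
  have hx : ∀ ⦃s t⦄, SRel q s t → FreeAlgebra.lift ℂ x s = FreeAlgebra.lift ℂ x t := by
    rintro _ _ (_ | _ | _ | _ | _ | _) <;> simp only [map_mul, map_smul, map_sub, lift_ι_apply]
    exacts [h.KE, h.KF, h.KK', h.K'E, h.K'F, h.EF]
  exact ⟨RingQuot.liftAlgHom ℂ ⟨FreeAlgebra.lift ℂ x, hx⟩, fun i => by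
    rw [gens_eq, RingQuot.liftAlgHom_mkAlgHom_apply, lift_ι_apply]⟩

lemma S1_eq (q : ℂ) : S1 q = Submodule.span ℂ (Set.range (gens q)) := by
  rw [S1]
  congr 1
  ext s
  simp [gens]
  tauto

lemma linePerpIdeal_eq (q : ℂ) (L : Submodule ℂ (Fin 4 → ℂ)) :
    linePerpIdeal q L = Submodule.span (SAlg q)
      {x | ∃ w : Fin 4 → ℂ, (∀ ζ ∈ L, ∑ i, w i * ζ i = 0) ∧ x = ∑ i, w i • gens q i} := by
  refine congrArg (Submodule.span (SAlg q)) (Set.ext fun x => ⟨?_, ?_⟩)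
  · rintro ⟨a, b, c, d, h, rfl⟩
    exact ⟨![a, b, c, d], by simpa [Fin.sum_univ_four] using h, by simp [Fin.sum_univ_four, gens]⟩
  · rintro ⟨w, h, rfl⟩
    exact ⟨w 0, w 1, w 2, w 3, by simpa [Fin.sum_univ_four] using h,
      by simp [Fin.sum_univ_four, gens]⟩

/-- The operators by which the generators act on `S / Sℓ^⊥`. -/
def lineOps (q : ℂ) (L : Submodule ℂ (Fin 4 → ℂ)) (i : Fin 4) :
    Module.End ℂ (SAlg q ⧸ linePerpIdeal q L) :=
  Algebra.lsmul ℂ ℂ (SAlg q ⧸ linePerpIdeal q L) (gens q i)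

lemma lineOps_mk (q : ℂ) (L : Submodule ℂ (Fin 4 → ℂ)) (i : Fin 4) (s : SAlg q) :
    lineOps q L i ((linePerpIdeal q L).mkQ s) = (linePerpIdeal q L).mkQ (gens q i * s) := rfl

lemma isSRep_lineOps (q : ℂ) (L : Submodule ℂ (Fin 4 → ℂ)) : IsSRep q (lineOps q L) :=
  (isSRep_gens q).map (Algebra.lsmul ℂ ℂ (SAlg q ⧸ linePerpIdeal q L))

lemma lineOps_annihilator (q : ℂ) (L : Submodule ℂ (Fin 4 → ℂ)) {w : Fin 4 → ℂ}
    (hw : ∀ ζ ∈ L, ∑ i, w i * ζ i = 0) :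
    ∑ i, w i • lineOps q L i ((linePerpIdeal q L).mkQ 1) = 0 := by
  have : ∑ i, w i • gens q i ∈ linePerpIdeal q L := by
    rw [linePerpIdeal_eq]
    exact Submodule.subset_span ⟨w, hw, rfl⟩
  simp only [lineOps_mk, mul_one]
  rw [← (Submodule.Quotient.mk_eq_zero _).2 this]
  exact (map_sum ((linePerpIdeal q L).mkQ.restrictScalars ℂ) (fun i => w i • gens q i) _).symm

lemma wordSpan_lineOps (q : ℂ) (L : Submodule ℂ (Fin 4 → ℂ)) (n : ℕ) :
    wordSpan (lineOps q L) ((linePerpIdeal q L).mkQ 1) n =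
      (S1 q ^ n).map ((linePerpIdeal q L).mkQ.restrictScalars ℂ) := by
  induction n with
  | zero =>
    rw [pow_zero, Submodule.one_eq_span, Submodule.map_span, Set.image_singleton]
    rfl
  | succ n ih =>
    rw [wordSpan, ih, pow_succ', S1_eq, Submodule.span_range_eq_iSup, Submodule.iSup_mul,
      Submodule.map_iSup]
    refine iSup_congr fun i => ?_
    ext y
    simp only [Submodule.mem_map, Submodule.mem_span_singleton_mul, exists_exists_and_eq_and]
    rfl

lemma IsModelled.finrank_eq {q : ℂ} {u v : Fin 4 → ℂ} (h : IsModelled q u v)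
    {L : Submodule ℂ (Fin 4 → ℂ)} (hu : u ∈ L) (hv : v ∈ L)
    (hL : ∀ ζ ∈ L, ∃ s t : ℂ, ζ = s • u + t • v) (n : ℕ) :
    Module.finrank ℂ ((S1 q ^ n).map ((linePerpIdeal q L).mkQ.restrictScalars ℂ)) = n + 1 := by
  rw [← wordSpan_lineOps]
  refine le_antisymm (h.upper _ _ _ (isSRep_lineOps q L) (fun w hwu hwv => ?_) n) ?_
  · refine lineOps_annihilator q L fun ζ hζ => ?_
    obtain ⟨s, t, rfl⟩ := hL ζ hζ
    calc ∑ i, w i * (s • u + t • v) i = s * ∑ i, w i * u i + t * ∑ i, w i * v i := by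
          simp only [Finset.mul_sum, ← Finset.sum_add_distrib]
          exact Finset.sum_congr rfl fun i _ => by simp; ring
      _ = 0 := by rw [hwu, hwv]; simp
  · obtain ⟨X, hX, h1, a, b, ha, hb⟩ := h.model
    obtain ⟨φ, hφ⟩ := hX.exists_algHom
    let ev : SAlg q →ₗ[ℂ] GridSpace := (LinearMap.applyₗ (grid 0 0)).comp φ.toLinearMap
    have hev : ∀ s, ev s = φ s (grid 0 0) := fun s => rfl
    have hker : (linePerpIdeal q L).restrictScalars ℂ ≤ LinearMap.ker ev := by
      intro s hs
      rw [Submodule.restrictScalars_mem, linePerpIdeal_eq] at hs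
      rw [LinearMap.mem_ker, hev]
      induction hs using Submodule.span_induction with
      | mem s hs =>
        obtain ⟨w, hw, rfl⟩ := hs
        simp only [map_sum, map_smul, hφ, LinearMap.sum_apply, LinearMap.smul_apply, h1,
          smul_add, smul_smul, Finset.sum_add_distrib, ← Finset.sum_smul, hw u hu, hw v hv]
        simp
      | zero => simp
      | add s t _ _ hs ht => simp [hs, ht]
      | smul r s _ hs => simp [hs]
    let τ : (SAlg q ⧸ linePerpIdeal q L) →ₗ[ℂ] GridSpace :=
      Submodule.liftQ ((linePerpIdeal q L).restrictScalars ℂ) ev hker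
    have hτ : ∀ s, τ ((linePerpIdeal q L).mkQ s) = φ s (grid 0 0) := fun s => rfl
    have hb' : ∀ j, (X b ^ j) (grid 0 0) = grid 0 j := fun j => by
      induction j with
      | zero => rfl
      | succ j ih => rw [pow_succ', Module.End.mul_apply, ih, hb]
    have ha' : ∀ i j, (X a ^ i) (grid 0 j) = grid i j := fun i j => by
      induction i with
      | zero => rfl
      | succ i ih => rw [pow_succ', Module.End.mul_apply, ih, ha]
    have hmem : ∀ k : Fin (n + 1), grid k (n - k) ∈
        (wordSpan (lineOps q L) ((linePerpIdeal q L).mkQ 1) n).map τ := fun k => by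
      rw [wordSpan_lineOps]
      refine ⟨_, ⟨gens q a ^ (k : ℕ) * gens q b ^ (n - k), ?_, rfl⟩, ?_⟩
      · have hg : ∀ i, gens q i ∈ S1 q := fun i => by
          rw [S1_eq]; exact Submodule.subset_span ⟨i, rfl⟩
        have := Submodule.mul_mem_mul (Submodule.pow_mem_pow _ (hg a) k)
          (Submodule.pow_mem_pow _ (hg b) (n - k))
        rwa [← pow_add, Nat.add_sub_cancel' (Nat.lt_succ_iff.1 k.2)] at this
      · refine (hτ _).trans ?_
        rw [map_mul, map_pow, map_pow, hφ, hφ, Module.End.mul_apply, hb', ha']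
    have hli : LinearIndependent ℂ fun k : Fin (n + 1) => grid k (n - k) :=
      (Finsupp.linearIndependent_single_one ℂ (ℕ × ℕ)).comp
        (fun k : Fin (n + 1) => ((k : ℕ), n - (k : ℕ)))
        fun k l hkl => Fin.ext (Prod.ext_iff.1 hkl).1
    have hcard := (LinearIndependent.of_comp (Submodule.subtype _)
      (v := fun k : Fin (n + 1) => (⟨_, hmem k⟩ :
        ↥((wordSpan (lineOps q L) ((linePerpIdeal q L).mkQ 1) n).map τ)))
      hli).fintype_card_le_finrank
    rw [Fintype.card_fin] at hcard
    exact hcard.trans (Submodule.finrank_map_le _ _)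

section Plane

variable {L : Submodule ℂ (Fin 4 → ℂ)}

/-- The restriction to `L` of the coordinates at `a` and `b`. -/
def coordPair (L : Submodule ℂ (Fin 4 → ℂ)) (a b : Fin 4) : L →ₗ[ℂ] ℂ × ℂ :=
  ((LinearMap.proj a).prod (LinearMap.proj b)).comp L.subtype

lemma coordPair_injective_iff_surjective (hL : Module.finrank ℂ L = 2) (a b : Fin 4) :
    Function.Injective (coordPair L a b) ↔ Function.Surjective (coordPair L a b) :=
  LinearMap.injective_iff_surjective_of_finrank_eq_finrank (by simp [hL])

lemma exists_adapted_basis (hL : Module.finrank ℂ L = 2) {a b : Fin 4}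
    (h : ∀ ζ ∈ L, ζ a = 0 → ζ b = 0 → ζ = 0) :
    ∃ u ∈ L, ∃ v ∈ L, u a = 1 ∧ u b = 0 ∧ v a = 0 ∧ v b = 1 ∧
      ∀ ζ ∈ L, ζ = ζ a • u + ζ b • v := by
  have hinj : Function.Injective (coordPair L a b) := by
    refine (injective_iff_map_eq_zero _).2 fun ζ hζ => Subtype.ext ?_
    obtain ⟨h1, h2⟩ := Prod.ext_iff.1 hζ
    exact h ζ ζ.2 h1 h2
  have hsurj := (coordPair_injective_iff_surjective hL a b).1 hinj
  obtain ⟨u, hu⟩ := hsurj (1, 0)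
  obtain ⟨v, hv⟩ := hsurj (0, 1)
  obtain ⟨hu1, hu2⟩ := Prod.ext_iff.1 hu
  obtain ⟨hv1, hv2⟩ := Prod.ext_iff.1 hv
  change (u : Fin 4 → ℂ) a = 1 at hu1
  change (u : Fin 4 → ℂ) b = 0 at hu2
  change (v : Fin 4 → ℂ) a = 0 at hv1
  change (v : Fin 4 → ℂ) b = 1 at hv2
  refine ⟨u, u.2, v, v.2, hu1, hu2, hv1, hv2, fun ζ hζ => ?_⟩
  rw [← sub_eq_zero]
  refine h _ (L.sub_mem hζ (L.add_mem (L.smul_mem _ u.2) (L.smul_mem _ v.2))) ?_ ?_ <;>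
    simp [hu1, hu2, hv1, hv2]

lemma eq_zero_of_det_ne_zero (hL : Module.finrank ℂ L = 2) {a b : Fin 4} {u v : Fin 4 → ℂ}
    (hu : u ∈ L) (hv : v ∈ L) (hdet : u a * v b - u b * v a ≠ 0) :
    ∀ ζ ∈ L, ζ a = 0 → ζ b = 0 → ζ = 0 := by
  have hsurj : Function.Surjective (coordPair L a b) := by
    rintro ⟨s, t⟩
    refine ⟨((s * v b - t * v a) / (u a * v b - u b * v a)) • ⟨u, hu⟩ +
      ((t * u a - s * u b) / (u a * v b - u b * v a)) • ⟨v, hv⟩, Prod.ext ?_ ?_⟩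
    · change (s * v b - t * v a) / (u a * v b - u b * v a) * u a +
        (t * u a - s * u b) / (u a * v b - u b * v a) * v a = s
      rw [div_mul_eq_mul_div, div_mul_eq_mul_div, ← add_div, div_eq_iff hdet]; ring
    · change (s * v b - t * v a) / (u a * v b - u b * v a) * u b +
        (t * u a - s * u b) / (u a * v b - u b * v a) * v b = t
      rw [div_mul_eq_mul_div, div_mul_eq_mul_div, ← add_div, div_eq_iff hdet]; ring
  intro ζ hζ h1 h2
  have := (injective_iff_map_eq_zero _).1
    ((coordPair_injective_iff_surjective hL a b).2 hsurj) ⟨ζ, hζ⟩ (Prod.ext h1 h2)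
  exact congrArg Subtype.val this

/-- Two linear forms whose product vanishes on `L` cannot both be nonzero on `L`. -/
lemma forall_eq_zero_or_forall_eq_zero {φ ψ : (Fin 4 → ℂ) →ₗ[ℂ] ℂ}
    (h : ∀ ζ ∈ L, φ ζ * ψ ζ = 0) : (∀ ζ ∈ L, φ ζ = 0) ∨ ∀ ζ ∈ L, ψ ζ = 0 := by
  by_contra! ⟨⟨v, hv, hv'⟩, w, hw, hw'⟩
  have h1 : ψ v = 0 := (mul_eq_zero.1 (h v hv)).resolve_left hv'
  have h2 : φ w = 0 := (mul_eq_zero.1 (h w hw)).resolve_right hw'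
  have h3 := h (v + w) (L.add_mem hv hw)
  simp [h1, h2, hv', hw'] at h3

end Plane

lemma sub_inv_ne_zero_of_sq_ne_one {q : ℂ} (hq : q ≠ 0) (hq2 : q ^ 2 ≠ 1) : q - q⁻¹ ≠ 0 := by
  intro h
  field_simp at h
  exact hq2 (by linear_combination h)

section Existence

variable {q : ℂ} {L : Submodule ℂ (Fin 4 → ℂ)}

/-- `L` has a basis `u`, `v` for which the line module is modelled. -/
def HasModel (q : ℂ) (L : Submodule ℂ (Fin 4 → ℂ)) : Prop :=
  ∃ u ∈ L, ∃ v ∈ L, IsModelled q u v ∧ ∀ ζ ∈ L, ∃ s t : ℂ, ζ = s • u + t • v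

lemma HasModel.of_map_perm (σ : Equiv.Perm (Fin 4)) (hσ : ∀ i, σ (σ i) = i)
    {q' : ℂ} (hM : ∀ u v, IsModelled q' u v → IsModelled q (u ∘ σ) (v ∘ σ))
    (h : HasModel q' (L.map (LinearMap.funLeft ℂ ℂ σ))) : HasModel q L := by
  have hinv : ∀ ζ : Fin 4 → ℂ, (ζ ∘ σ) ∘ σ = ζ := fun ζ => funext fun i => by simp [hσ]
  obtain ⟨_, ⟨u, hu, rfl⟩, _, ⟨v, hv, rfl⟩, hmod, hspan⟩ := h
  have hmod' := hM _ _ hmod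
  change IsModelled q ((u ∘ σ) ∘ σ) ((v ∘ σ) ∘ σ) at hmod'
  rw [hinv, hinv] at hmod'
  refine ⟨u, hu, v, hv, hmod', fun ζ hζ => ?_⟩
  obtain ⟨s, t, hst⟩ := hspan _ ⟨ζ, hζ, rfl⟩
  refine ⟨s, t, ?_⟩
  rw [← hinv ζ]
  change (LinearMap.funLeft ℂ ℂ σ ζ) ∘ σ = _
  rw [hst]
  exact funext fun i => by simp [LinearMap.funLeft_apply, hσ]

lemma finrank_map_funLeft (σ : Equiv.Perm (Fin 4)) :
    Module.finrank ℂ (L.map (LinearMap.funLeft ℂ ℂ σ)) = Module.finrank ℂ L :=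
  (Submodule.equivMapOfInjective _
    (LinearMap.funLeft_injective_of_surjective _ _ _ σ.surjective) L).finrank_eq.symm

lemma hasModel_of_FK' (hq : q ≠ 0) (hs : q - q⁻¹ ≠ 0) (hL : Module.finrank ℂ L = 2) {c : ℂ}
    (hK : ∀ ζ ∈ L, ζ 2 = c * ζ 3) (hE : c = 0 ∨ ∀ ζ ∈ L, ζ 0 = 0)
    (h : ∀ ζ ∈ L, ζ 1 = 0 → ζ 3 = 0 → ζ = 0) : HasModel q L := by
  obtain ⟨u, hu, v, hv, hu1, hu3, hv1, hv3, hspan⟩ := exists_adapted_basis hL h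
  have hu' : u = ![u 0, 1, 0, 0] := by
    ext i; fin_cases i <;> simp [hu1, hu3, hK u hu]
  have hv' : v = ![v 0, 0, c, 1] := by
    ext i; fin_cases i <;> simp [hv1, hv3, hK v hv]
  refine ⟨u, hu, v, hv, ?_, fun ζ hζ => ⟨_, _, hspan ζ hζ⟩⟩
  rw [hu', hv']
  exact isModelled_FK' hq hs (hE.imp_right fun h0 => ⟨h0 u hu, h0 v hv⟩)

lemma hasModel_of_EK' (hq : q ≠ 0) (hs : q - q⁻¹ ≠ 0) (hL : Module.finrank ℂ L = 2) {c : ℂ}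
    (hK : ∀ ζ ∈ L, ζ 2 = c * ζ 3) (hF : c = 0 ∨ ∀ ζ ∈ L, ζ 1 = 0)
    (h : ∀ ζ ∈ L, ζ 0 = 0 → ζ 3 = 0 → ζ = 0) : HasModel q L := by
  have e0 : (Equiv.swap 0 1 : Equiv.Perm (Fin 4)) 0 = 1 := by decide
  have e1 : (Equiv.swap 0 1 : Equiv.Perm (Fin 4)) 1 = 0 := by decide
  have e2 : (Equiv.swap 0 1 : Equiv.Perm (Fin 4)) 2 = 2 := by decide
  have e3 : (Equiv.swap 0 1 : Equiv.Perm (Fin 4)) 3 = 3 := by decide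
  refine HasModel.of_map_perm (Equiv.swap 0 1) (by simp) (q' := q⁻¹)
    (fun u v hM => hM.swapEF) (hasModel_of_FK' (c := c) (inv_ne_zero hq) ?_ ?_ ?_ ?_ ?_)
  · rwa [inv_inv, ← neg_sub, neg_ne_zero]
  · rw [finrank_map_funLeft, hL]
  · rintro _ ⟨ζ, hζ, rfl⟩
    simpa [LinearMap.funLeft_apply, e2, e3] using hK ζ hζ
  · refine hF.imp_right ?_
    rintro hF _ ⟨ζ, hζ, rfl⟩
    simpa [LinearMap.funLeft_apply, e0] using hF ζ hζ
  · rintro _ ⟨ζ, hζ, rfl⟩ h1 h3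
    rw [LinearMap.funLeft_apply, e1] at h1
    rw [LinearMap.funLeft_apply, e3] at h3
    rw [h ζ hζ h1 h3, map_zero]

lemma hasModel_of_K_eq_zero (hq : q ≠ 0) (hs : q - q⁻¹ ≠ 0) (hL : Module.finrank ℂ L = 2)
    (hK : ∀ ζ ∈ L, ζ 2 = 0) : HasModel q L := by
  by_cases hF : ∀ ζ ∈ L, ζ 1 = 0 → ζ 3 = 0 → ζ = 0
  · exact hasModel_of_FK' (c := 0) hq hs hL (by simpa using hK) (.inl rfl) hF
  by_cases hE : ∀ ζ ∈ L, ζ 0 = 0 → ζ 3 = 0 → ζ = 0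
  · exact hasModel_of_EK' (c := 0) hq hs hL (by simpa using hK) (.inl rfl) hE
  push Not at hF hE
  obtain ⟨ζ, hζ, hζ1, hζ3, hζ0⟩ := hF
  obtain ⟨η, hη, hη0, hη3, hη1⟩ := hE
  have hζ0' : ζ 0 ≠ 0 := fun h0 => hζ0 (by ext i; fin_cases i <;> simp [h0, hζ1, hζ3, hK ζ hζ])
  have hη1' : η 1 ≠ 0 := fun h0 => hη1 (by ext i; fin_cases i <;> simp [h0, hη0, hη3, hK η hη])
  have hinj := eq_zero_of_det_ne_zero (a := 0) (b := 1) hL hζ hη (by simp [hζ0', hζ1, hη1'])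
  obtain ⟨u, hu, v, hv, hu0, hu1, hv0, hv1, hspan⟩ := exists_adapted_basis hL hinj
  have hu3 : u 3 = 0 := by
    have := congr_fun (hspan ζ hζ) 3
    simpa [hζ3, hζ1, hζ0'] using this.symm
  have hv3 : v 3 = 0 := by
    have := congr_fun (hspan η hη) 3
    simpa [hη3, hη0, hη1'] using this.symm
  have hu' : u = ![1, 0, 0, 0] := by
    ext i; fin_cases i <;> simp [hu0, hu1, hu3, hK u hu]
  have hv' : v = ![0, 1, 0, 0] := by
    ext i; fin_cases i <;> simp [hv0, hv1, hv3, hK v hv]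
  refine ⟨u, hu, v, hv, ?_, fun ζ hζ => ⟨_, _, hspan ζ hζ⟩⟩
  rw [hu', hv']
  exact isModelled_EF hs

lemma hasModel_of_K'_eq_zero (hq : q ≠ 0) (hs : q - q⁻¹ ≠ 0) (hL : Module.finrank ℂ L = 2)
    (hK : ∀ ζ ∈ L, ζ 3 = 0) : HasModel q L := by
  have e2 : (Equiv.swap 2 3 : Equiv.Perm (Fin 4)) 2 = 3 := by decide
  refine HasModel.of_map_perm (Equiv.swap 2 3) (by simp) (q' := q⁻¹)
    (fun u v hM => hM.swapKK') (hasModel_of_K_eq_zero (inv_ne_zero hq) ?_ ?_ ?_)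
  · rwa [inv_inv, ← neg_sub, neg_ne_zero]
  · rw [finrank_map_funLeft, hL]
  · rintro _ ⟨ζ, hζ, rfl⟩
    simpa [LinearMap.funLeft_apply, e2] using hK ζ hζ

lemma hasModel_of_KK'_eq_zero (hq : q ≠ 0) (hs : q - q⁻¹ ≠ 0) (hL : Module.finrank ℂ L = 2)
    (h : ∀ ζ ∈ L, ζ 2 * ζ 3 = 0) : HasModel q L := by
  rcases forall_eq_zero_or_forall_eq_zero (φ := LinearMap.proj 2) (ψ := LinearMap.proj 3) h
    with h | h
  · exact hasModel_of_K_eq_zero hq hs hL h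
  · exact hasModel_of_K'_eq_zero hq hs hL h

lemma hasModel_of_quadric (hq : q ≠ 0) (hs : q - q⁻¹ ≠ 0) (hL : Module.finrank ℂ L = 2)
    {l : ℂ} (hl : l ≠ 0) (h : ∀ v ∈ L, (q - q⁻¹) ^ 2 * (v 0 * v 1) +
      (v 2 - l * v 3) * (v 2 - l⁻¹ * v 3) = 0) : HasModel q L := by
  by_cases hKK' : ∀ ζ ∈ L, ζ 2 = 0 → ζ 3 = 0 → ζ = 0
  · obtain ⟨u, hu, v, hv, hu2, hu3, hv2, hv3, hspan⟩ := exists_adapted_basis hL hKK'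
    have hu' : u = ![u 0, u 1, 1, 0] := by
      ext i; fin_cases i <;> simp [hu2, hu3]
    have hv' : v = ![v 0, v 1, 0, 1] := by
      ext i; fin_cases i <;> simp [hv2, hv3]
    refine ⟨u, hu, v, hv, ?_, fun ζ hζ => ⟨_, _, hspan ζ hζ⟩⟩
    rw [hu', hv']
    have h1 := h u hu
    have h2 := h v hv
    rw [hu2, hu3] at h1
    rw [hv2, hv3] at h2
    refine isModelled_KK' hq ?_ ?_
    · linear_combination h1
    · linear_combination h2 - mul_inv_cancel₀ hl
  push Not at hKK'
  obtain ⟨ζ, hζ, hζ2, hζ3, hζ0⟩ := hKK'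
  have hpair : ∀ v ∈ L, ζ 0 * v 1 + v 0 * ζ 1 = 0 := fun v hv => by
    have h1 := h (v + ζ) (L.add_mem hv hζ)
    have h2 := h v hv
    have h3 := h ζ hζ
    simp only [Pi.add_apply, hζ2, hζ3] at h1 h3
    refine (mul_eq_zero.1 ?_).resolve_left (pow_ne_zero 2 hs)
    linear_combination h1 - h2 - h3
  have hlin : (∀ v ∈ L, v 0 * v 1 = 0) → ∃ c : ℂ, ∀ v ∈ L, v 2 = c * v 3 := fun h0 => by
    rcases forall_eq_zero_or_forall_eq_zero (L := L)
      (φ := (LinearMap.proj 2 - l • LinearMap.proj 3 : (Fin 4 → ℂ) →ₗ[ℂ] ℂ))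
      (ψ := (LinearMap.proj 2 - l⁻¹ • LinearMap.proj 3 : (Fin 4 → ℂ) →ₗ[ℂ] ℂ))
      (fun v hv => by simpa [h0 v hv] using h v hv) with h1 | h1
    · exact ⟨l, fun v hv => sub_eq_zero.1 (h1 v hv)⟩
    · exact ⟨l⁻¹, fun v hv => sub_eq_zero.1 (h1 v hv)⟩
  have h01 : ζ 0 * ζ 1 = 0 := by linear_combination (hpair ζ hζ) / 2
  rcases mul_eq_zero.1 h01 with h0 | h1
  · have hζ1 : ζ 1 ≠ 0 := fun h1 =>
      hζ0 (by ext i; fin_cases i <;> simp [h0, h1, hζ2, hζ3])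
    have hE : ∀ v ∈ L, v 0 = 0 := fun v hv => by simpa [h0, hζ1] using hpair v hv
    obtain ⟨c, hc⟩ := hlin fun v hv => by simp [hE v hv]
    refine hasModel_of_FK' hq hs hL hc (.inr hE) fun v hv h1 h3 => ?_
    ext i; fin_cases i <;> simp [hE v hv, h1, h3, hc v hv]
  · have hζ0' : ζ 0 ≠ 0 := fun h0 =>
      hζ0 (by ext i; fin_cases i <;> simp [h0, h1, hζ2, hζ3])
    have hF : ∀ v ∈ L, v 1 = 0 := fun v hv => by simpa [h1, hζ0'] using hpair v hv
    obtain ⟨c, hc⟩ := hlin fun v hv => by simp [hF v hv]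
    refine hasModel_of_EK' hq hs hL hc (.inr hF) fun v hv h1 h3 => ?_
    ext i; fin_cases i <;> simp [hF v hv, h1, h3, hc v hv]

end Existence

section DegreeTwo

/-- The matrix of coefficients of a linear combination of the six defining relations of `S`. -/
def relMatrix (q : ℂ) : (Fin 6 → ℂ) →ₗ[ℂ] Matrix (Fin 4) (Fin 4) ℂ where
  toFun r := !![0, r 5 * (q - q⁻¹), -(q * r 0), -(q⁻¹ * r 3);
    -(r 5 * (q - q⁻¹)), 0, -(q⁻¹ * r 1), -(q * r 4);
    r 0, r 1, -r 5, r 2;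
    r 3, r 4, -r 2, r 5]
  map_add' r s := by
    ext i j; fin_cases i <;> fin_cases j <;> simp <;> ring
  map_smul' t r := by
    ext i j; fin_cases i <;> fin_cases j <;> simp <;> ring

lemma relMatrix_injective (q : ℂ) : Function.Injective (relMatrix q) := by
  intro r s h
  have hrs := fun i j => congr_fun (congr_fun h i) j
  ext i
  fin_cases i
  exacts [hrs 2 0, hrs 2 1, hrs 2 3, hrs 3 0, hrs 3 1, hrs 3 3]

/-- The linear map sending a matrix `A` to the quadratic expression `∑ A i j x_i x_j m`. -/
def quadEval {V : Type} [AddCommGroup V] [Module ℂ V] (x : Fin 4 → Module.End ℂ V) (m : V) :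
    Matrix (Fin 4) (Fin 4) ℂ →ₗ[ℂ] V where
  toFun A := ∑ i, x i (∑ j, A i j • x j m)
  map_add' A B := by simp [add_smul, Finset.sum_add_distrib]
  map_smul' t A := by simp [mul_smul, Finset.smul_sum]

variable {V : Type} [AddCommGroup V] [Module ℂ V] {q : ℂ} {x : Fin 4 → Module.End ℂ V} {m : V}

lemma wordSpan_two_le_range_quadEval : wordSpan x m 2 ≤ LinearMap.range (quadEval x m) := by
  refine wordSpan_succ_le fun c => ?_
  refine fun w hw => (?_ : w ∈ (LinearMap.range (quadEval x m)).comap (x c))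
  refine wordSpan_succ_le (fun d => ?_) hw
  intro w hw
  obtain ⟨t, rfl⟩ := Submodule.mem_span_singleton.1 hw
  refine ⟨Matrix.single c d t, ?_⟩
  simp only [quadEval, LinearMap.coe_mk, AddHom.coe_mk]
  rw [Finset.sum_eq_single c, Finset.sum_eq_single d] <;>
    simp +contextual [Matrix.single_apply, eq_comm]

lemma IsSRep.quadEval_relMatrix (h : IsSRep q x) (r : Fin 6 → ℂ) :
    quadEval x m (relMatrix q r) = 0 := by
  have h1 := congr($(h.KE) m)
  have h2 := congr($(h.KF) m)
  have h3 := congr($(h.KK') m)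
  have h4 := congr($(h.K'E) m)
  have h5 := congr($(h.K'F) m)
  have h6 := congr($(h.EF) m)
  simp only [LinearMap.smul_apply, LinearMap.sub_apply, Module.End.mul_apply] at h1 h2 h3 h4 h5 h6
  simp [quadEval, relMatrix, Fin.sum_univ_four]
  rw [h1, h2, h3, h4, h5, ← sub_add_cancel (x 2 (x 2 m)) (x 3 (x 3 m)), ← h6]
  module

/-- The map sending a matrix to its products with two given vectors. -/
def mulVecPair (u v : Fin 4 → ℂ) :
    Matrix (Fin 4) (Fin 4) ℂ →ₗ[ℂ] (Fin 4 → ℂ) × (Fin 4 → ℂ) :=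
  ((Matrix.mulVecBilin ℂ ℂ).flip u).prod ((Matrix.mulVecBilin ℂ ℂ).flip v)

lemma IsSRep.exists_relMatrix_of_finrank (h : IsSRep q x) {u v : Fin 4 → ℂ}
    (hm : ∀ w : Fin 4 → ℂ, ∑ i, w i * u i = 0 → ∑ i, w i * v i = 0 → ∑ i, w i • x i m = 0)
    (hfin : 3 ≤ Module.finrank ℂ (wordSpan x m 2)) :
    ∃ r ≠ 0, (relMatrix q r).mulVec u = 0 ∧ (relMatrix q r).mulVec v = 0 := by
  by_contra! hne
  let R := LinearMap.range (relMatrix q)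
  let N := LinearMap.ker (mulVecPair u v)
  have hinf : R ⊓ N = ⊥ := by
    rw [eq_bot_iff]
    rintro _ ⟨⟨r, rfl⟩, hN⟩
    obtain ⟨h1, h2⟩ := Prod.ext_iff.1 (LinearMap.mem_ker.1 hN)
    by_contra hr
    refine hne r (fun hr0 => hr ?_) h1 h2
    rw [hr0, map_zero]
    exact Submodule.zero_mem _
  have hR : Module.finrank ℂ R = 6 := by
    rw [LinearMap.finrank_range_of_inj (relMatrix_injective q)]; simp
  have hN := LinearMap.finrank_range_add_finrank_ker (mulVecPair u v)
  have hN' := Submodule.finrank_le (LinearMap.range (mulVecPair u v))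
  have hle : R ⊔ N ≤ LinearMap.ker (quadEval x m) := by
    refine sup_le ?_ fun A hA => ?_
    · rintro _ ⟨r, rfl⟩
      exact h.quadEval_relMatrix r
    · obtain ⟨h1, h2⟩ := Prod.ext_iff.1 (LinearMap.mem_ker.1 hA)
      rw [LinearMap.mem_ker]
      change ∑ i, x i (∑ j, A i j • x j m) = 0
      refine Finset.sum_eq_zero fun i _ => ?_
      rw [hm (A i) (congr_fun h1 i) (congr_fun h2 i), map_zero]
  have hsup := Submodule.finrank_sup_add_finrank_inf_eq R N
  have hker := Submodule.finrank_mono hle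
  have hrk := LinearMap.finrank_range_add_finrank_ker (quadEval x m)
  have hW := Submodule.finrank_mono (wordSpan_two_le_range_quadEval (x := x) (m := m))
  rw [hinf, finrank_bot] at hsup
  simp [Module.finrank_matrix] at hN hN' hrk
  change _ + Module.finrank ℂ N = _ at hN
  omega

end DegreeTwo

lemma quadric_of_relMatrix {q : ℂ} (hq : q ≠ 0) (hq4 : q ^ 4 ≠ 1)
    {L : Submodule ℂ (Fin 4 → ℂ)} (hL : Module.finrank ℂ L = 2) {r : Fin 6 → ℂ} (hr : r ≠ 0)
    (h : ∀ ζ ∈ L, (relMatrix q r).mulVec ζ = 0) :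
    (∃ l : ℂ, l ≠ 0 ∧ ∀ v ∈ L,
      (q - q⁻¹) ^ 2 * (v 0 * v 1) + (v 2 - l * v 3) * (v 2 - l⁻¹ * v 3) = 0) ∨
      ∀ v ∈ L, v 2 * v 3 = 0 := by
  have hq2 : q ^ 2 ≠ 1 := fun h2 => hq4 (by linear_combination (q ^ 2 + 1) * h2)
  have hq2' : q ^ 2 + 1 ≠ 0 := fun h2 => hq4 (by linear_combination (q ^ 2 - 1) * h2)
  have hs := sub_inv_ne_zero_of_sq_ne_one hq hq2
  have hE : ∀ ζ ∈ L, r 5 * (q - q⁻¹) * ζ 1 - q * r 0 * ζ 2 - q⁻¹ * r 3 * ζ 3 = 0 := fun ζ hζ => by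
    have := congr_fun (h ζ hζ) 0
    simp [relMatrix, Matrix.mulVec, dotProduct, Fin.sum_univ_four] at this
    linear_combination this
  have hF : ∀ ζ ∈ L, r 5 * (q - q⁻¹) * ζ 0 + q⁻¹ * r 1 * ζ 2 + q * r 4 * ζ 3 = 0 := fun ζ hζ => by
    have := congr_fun (h ζ hζ) 1
    simp [relMatrix, Matrix.mulVec, dotProduct, Fin.sum_univ_four] at this
    linear_combination -this
  have hK : ∀ ζ ∈ L, r 0 * ζ 0 + r 1 * ζ 1 - r 5 * ζ 2 + r 2 * ζ 3 = 0 := fun ζ hζ => by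
    have := congr_fun (h ζ hζ) 2
    simp [relMatrix, Matrix.mulVec, dotProduct, Fin.sum_univ_four] at this
    linear_combination this
  have hK' : ∀ ζ ∈ L, r 3 * ζ 0 + r 4 * ζ 1 - r 2 * ζ 2 + r 5 * ζ 3 = 0 := fun ζ hζ => by
    have := congr_fun (h ζ hζ) 3
    simp [relMatrix, Matrix.mulVec, dotProduct, Fin.sum_univ_four] at this
    linear_combination this
  by_cases hinj : ∀ ζ ∈ L, ζ 2 = 0 → ζ 3 = 0 → ζ = 0
  · obtain ⟨u, hu, v, hv, hu2, hu3, hv2, hv3, hspan⟩ := exists_adapted_basis hL hinj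
    have hEu := hE u hu
    have hEv := hE v hv
    have hFu := hF u hu
    have hFv := hF v hv
    have hKu := hK u hu
    have hKv := hK v hv
    have hK'u := hK' u hu
    have hK'v := hK' v hv
    rw [hu2, hu3] at hEu hFu hKu hK'u
    rw [hv2, hv3] at hEv hFv hKv hK'v
    by_cases h5 : r 5 = 0
    · exfalso
      have h0 : r 0 = 0 := by simpa [h5, hq] using hEu
      have h3 : r 3 = 0 := by simpa [h5, hq] using hEv
      have h1 : r 1 = 0 := by simpa [h5, hq] using hFu
      have h4 : r 4 = 0 := by simpa [h5, hq] using hFv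
      have h2 : r 2 = 0 := by simpa [h5, h0, h1] using hKv
      exact hr (by ext i; fin_cases i <;> simp [h0, h1, h2, h3, h4, h5])
    have h01 : r 0 * r 1 = r 5 ^ 2 := by
      refine mul_left_cancel₀ hs ?_
      linear_combination r 5 * (q - q⁻¹) * hKu - r 0 * hFu - r 1 * hEu
    have h34 : r 3 * r 4 = r 5 ^ 2 := by
      refine mul_left_cancel₀ hs ?_
      linear_combination -r 5 * (q - q⁻¹) * hK'v + r 3 * hFv + r 4 * hEv
    have h0 : r 0 ≠ 0 := fun h0 => h5 (by simpa [h0] using h01.symm)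
    have h3 : r 3 ≠ 0 := fun h3 => h5 (by simpa [h3] using h34.symm)
    refine .inl ⟨-(q ^ 2 * r 0 / r 3), by simp [hq, h0, h3], fun ζ hζ => ?_⟩
    refine mul_left_cancel₀ (pow_ne_zero 2 h5) ?_
    have e1 : r 1 = r 5 ^ 2 / r 0 := by field_simp; linear_combination h01
    have e4 : r 4 = r 5 ^ 2 / r 3 := by field_simp; linear_combination h34
    have hE' : r 5 * (q - q⁻¹) * ζ 1 = q * r 0 * ζ 2 + q⁻¹ * r 3 * ζ 3 := by
      linear_combination hE ζ hζ
    have hF' : r 5 * (q - q⁻¹) * ζ 0 = -(q⁻¹ * r 1 * ζ 2 + q * r 4 * ζ 3) := by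
      linear_combination hF ζ hζ
    calc _ = (r 5 * (q - q⁻¹) * ζ 0) * (r 5 * (q - q⁻¹) * ζ 1) + r 5 ^ 2 *
          ((ζ 2 - -(q ^ 2 * r 0 / r 3) * ζ 3) * (ζ 2 - (-(q ^ 2 * r 0 / r 3))⁻¹ * ζ 3)) := by ring
      _ = _ := by
        rw [hE', hF', e1, e4, inv_neg, inv_div]
        field_simp
        ring
  push Not at hinj
  obtain ⟨ζ, hζ, hζ2, hζ3, hζ0⟩ := hinj
  have h5 : r 5 = 0 := by
    by_contra h5
    have h1 : ζ 1 = 0 := by simpa [h5, hs, hζ2, hζ3] using hE ζ hζ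
    have h0 : ζ 0 = 0 := by simpa [h5, hs, hζ2, hζ3] using hF ζ hζ
    exact hζ0 (by ext i; fin_cases i <;> simp [h0, h1, hζ2, hζ3])
  by_cases hK0 : ∀ v ∈ L, v 3 = 0
  · exact .inr fun v hv => by simp [hK0 v hv]
  push Not at hK0
  obtain ⟨η, hη, hη3⟩ := hK0
  obtain ⟨c, hc⟩ : ∃ c : ℂ, ∀ v ∈ L, v 2 = c * v 3 := by
    refine ⟨η 2 / η 3, fun v hv => ?_⟩
    have hdet : v 2 * η 3 - v 3 * η 2 = 0 := by
      by_contra hdet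
      exact hζ0 (eq_zero_of_det_ne_zero hL hv hη hdet ζ hζ hζ2 hζ3)
    field_simp
    linear_combination hdet
  by_cases hc0 : c = 0
  · exact .inr fun v hv => by simp [hc v hv, hc0]
  refine .inl ⟨c, hc0, fun v hv => ?_⟩
  suffices hv01 : v 0 * v 1 = 0 by rw [hv01, hc v hv]; ring
  have h3 : r 3 = -(q ^ 2 * c * r 0) := by
    have := hE η hη
    rw [h5, hc η hη] at this
    field_simp at this
    refine mul_left_cancel₀ hη3 ?_
    linear_combination -this
  have h4 : q ^ 2 * r 4 = -(c * r 1) := by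
    have := hF η hη
    rw [h5, hc η hη] at this
    field_simp at this
    refine mul_left_cancel₀ hη3 ?_
    linear_combination this
  have hrel : ∀ w ∈ L, q ^ 2 * (r 0 * w 0) = r 1 * w 1 := fun w hw => by
    have h1 := hK w hw
    have h2 := hK' w hw
    rw [h5, hc w hw] at h1 h2
    refine mul_left_cancel₀ (mul_ne_zero hc0 (sub_ne_zero.2 hq2)) ?_
    linear_combination -q ^ 2 * h2 - c * q ^ 2 * h1 + q ^ 2 * w 0 * h3 + w 1 * h4
  have h10 : r 1 * ζ 1 + r 0 * ζ 0 = 0 := by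
    have := hK ζ hζ
    rw [h5, hζ3] at this
    linear_combination this
  have hζ0' : r 0 * ζ 0 = 0 := by
    refine (mul_eq_zero.1 ?_).resolve_left hq2'
    linear_combination hrel ζ hζ + h10
  have hζ1' : r 1 * ζ 1 = 0 := by linear_combination h10 - hζ0'
  by_cases h0 : r 0 = 0
  · by_cases h1 : r 1 = 0
    · have h3' : r 3 = 0 := by simp [h3, h0]
      have h4' : r 4 = 0 := by simpa [h1, hq] using h4
      have h2 : r 2 = 0 := by simpa [h0, h1, h5, hη3] using hK η hη
      exact absurd (by ext i; fin_cases i <;> simp [h0, h1, h2, h3', h4', h5]) hr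
    · have : v 1 = 0 := by simpa [h0, h1, eq_comm] using hrel v hv
      rw [this, mul_zero]
  · by_cases h1 : r 1 = 0
    · have : v 0 = 0 := by simpa [h0, h1, hq] using hrel v hv
      rw [this, zero_mul]
    · refine absurd ?_ hζ0
      have e0 : ζ 0 = 0 := by simpa [h0] using hζ0'
      have e1 : ζ 1 = 0 := by simpa [h1] using hζ1'
      ext i; fin_cases i <;> simp [e0, e1, hζ2, hζ3]

/-- For a 2-dimensional subspace `L ⊆ ℂ⁴`, `M = S/Sℓ^⊥` is a line module (its degree-`n`
component, the image of the span of the length-`n` words in the generators, has dimension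
`n+1` for all `n ≥ 0`) iff either some `g_λ` (`λ ≠ 0`) vanishes identically on `L`, or the
quadratic form `kk′` vanishes identically on `L`; i.e. iff the line `ℙ(L) ⊆ ℙ³` lies on
one of the quadrics `Q(λ)` of the pencil, where `Q(0) = Q(∞) = {kk′ = 0}`.
Coordinates on `S₁* = ℂ⁴`: `v 0 = e`, `v 1 = f`, `v 2 = k`, `v 3 = k′`, and
`g_λ(v) = κ⁻²ef + (k − λk′)(k − λ⁻¹k′)`. -/
theorem stmt_6 (q : ℂ) (hq0 : q ≠ 0) (hroot : ∀ m : ℕ, 0 < m → q ^ m ≠ 1)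
    (κ : ℂ) (hκ : κ = (q⁻¹ - q)⁻¹)
    (L : Submodule ℂ (Fin 4 → ℂ)) (hL : Module.finrank ℂ L = 2) :
    (∀ n : ℕ,
      Module.finrank ℂ
        ↥(Submodule.map
            (((linePerpIdeal q L).mkQ).restrictScalars ℂ) (S1 q ^ n)) = n + 1)
    ↔ ((∃ l : ℂ, l ≠ 0 ∧ ∀ v ∈ L,
          (κ ^ 2)⁻¹ * (v 0 * v 1) + (v 2 - l * v 3) * (v 2 - l⁻¹ * v 3) = 0)
      ∨ (∀ v ∈ L, v 2 * v 3 = 0)) := by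
  have hq2 : q ^ 2 ≠ 1 := hroot 2 two_pos
  have hs := sub_inv_ne_zero_of_sq_ne_one hq0 hq2
  have hκ2 : (κ ^ 2)⁻¹ = (q - q⁻¹) ^ 2 := by
    rw [hκ, inv_pow, inv_inv]
    ring
  rw [hκ2]
  constructor
  · intro h
    have h2 := h 2
    rw [← wordSpan_lineOps] at h2
    obtain ⟨u, v, huv⟩ : ∃ u v : Fin 4 → ℂ, ∀ ζ ∈ L, ∃ s t : ℂ, ζ = s • u + t • v := by
      let b := Module.finBasisOfFinrankEq ℂ L hL
      refine ⟨b 0, b 1, fun ζ hζ => ⟨b.repr ⟨ζ, hζ⟩ 0, b.repr ⟨ζ, hζ⟩ 1, ?_⟩⟩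
      have := b.sum_repr ⟨ζ, hζ⟩
      rw [Fin.sum_univ_two] at this
      exact congrArg Subtype.val this.symm
    have hann (w : Fin 4 → ℂ) (hwu : ∑ i, w i * u i = 0) (hwv : ∑ i, w i * v i = 0) :
        ∑ i, w i • lineOps q L i ((linePerpIdeal q L).mkQ 1) = 0 := by
      refine lineOps_annihilator q L fun ζ hζ => ?_
      obtain ⟨s, t, rfl⟩ := huv ζ hζ
      change w ⬝ᵥ _ = 0
      rw [dotProduct_add, dotProduct_smul, dotProduct_smul]
      simp [dotProduct, hwu, hwv]
    obtain ⟨r, hr, hru, hrv⟩ := (isSRep_lineOps q L).exists_relMatrix_of_finrank hann h2.ge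
    refine quadric_of_relMatrix hq0 (hroot 4 (by norm_num)) hL hr fun ζ hζ => ?_
    obtain ⟨s, t, rfl⟩ := huv ζ hζ
    simp [Matrix.mulVec_add, Matrix.mulVec_smul, hru, hrv]
  · intro h n
    obtain ⟨u, hu, v, hv, hM, hspan⟩ : HasModel q L := by
      rcases h with ⟨l, hl, h⟩ | h
      · exact hasModel_of_quadric hq0 hs hL hl h
      · exact hasModel_of_KK'_eq_zero hq0 hs hL h
    exact hM.finrank_eq hu hv hspan n
end
end

section
/- The set {v ∈ ℂ⁴ : g_λ(v) = 0 for every λ ∈ ℂ ∖ {0}} equals cone(C) ∪ cone(C′). (The base locus of the pencil of quadrics Q(λ) is C ∪ C′.) -/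
noncomputable section

/-- `g_λ(v) = κ⁻²ef + (k − λk′)(k − λ⁻¹k′)`, as a function of `v = (e,f,k,k′) ∈ ℂ⁴`. -/
def gfun (κ l : ℂ) (v : Fin 4 → ℂ) : ℂ :=
  (κ ^ 2)⁻¹ * (v 0 * v 1) + (v 2 - l * v 3) * (v 2 - l⁻¹ * v 3)

/-- Clearing the denominator `κ²` in `g_λ`. -/
theorem sq_mul_gfun {κ l : ℂ} (hκ : κ ≠ 0) (hl : l ≠ 0) (v : Fin 4 → ℂ) :
    κ ^ 2 * gfun κ l v =
      v 0 * v 1 + κ ^ 2 * (v 2 ^ 2 + v 3 ^ 2 - (l + l⁻¹) * (v 2 * v 3)) := by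
  unfold gfun
  field_simp
  ring

theorem inv_sub_self_ne_zero {q : ℂ} (hq0 : q ≠ 0) (hq1 : q ≠ 1) (hqm1 : q ≠ -1) :
    q⁻¹ - q ≠ 0 := by
  intro h
  have hsq : q * q = 1 := by
    nth_rewrite 1 [← sub_eq_zero.mp h]
    exact inv_mul_cancel₀ hq0
  exact (mul_self_eq_one_iff.mp hsq).elim hq1 hqm1

/-- The base locus of the pencil of quadrics `Q(λ)` is `C ∪ C′`:
`{v ∈ ℂ⁴ : g_λ(v) = 0 for all λ ≠ 0} = cone(C) ∪ cone(C′)`. -/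
theorem stmt_7 (q κ : ℂ) (hq0 : q ≠ 0) (hq1 : q ≠ 1) (hqm1 : q ≠ -1)
    (hκ : κ = (q⁻¹ - q)⁻¹) :
    {v : Fin 4 → ℂ | ∀ l : ℂ, l ≠ 0 → gfun κ l v = 0}
      = {v : Fin 4 → ℂ | v 3 = 0 ∧ v 0 * v 1 + κ ^ 2 * (v 2) ^ 2 = 0}
        ∪ {v : Fin 4 → ℂ | v 2 = 0 ∧ v 0 * v 1 + κ ^ 2 * (v 3) ^ 2 = 0} := by
  have hκ0 : κ ≠ 0 := hκ ▸ inv_ne_zero (inv_sub_self_ne_zero hq0 hq1 hqm1)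
  ext v
  simp only [Set.mem_ofPred_eq, Set.mem_union]
  constructor
  · intro h
    have h_one := sq_mul_gfun hκ0 one_ne_zero v
    have h_neg := sq_mul_gfun hκ0 (neg_ne_zero.mpr one_ne_zero) v
    rw [h _ one_ne_zero, inv_one] at h_one
    rw [h _ (neg_ne_zero.mpr one_ne_zero), inv_neg, inv_one] at h_neg
    have hprod : κ ^ 2 * (v 2 * v 3) = 0 := by linear_combination (h_one - h_neg) / 4
    rcases mul_eq_zero.mp ((mul_eq_zero.mp hprod).resolve_left (pow_ne_zero 2 hκ0)) with h2 | h3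
    · exact Or.inr ⟨h2, by rw [h2] at h_one; linear_combination -h_one⟩
    · exact Or.inl ⟨h3, by rw [h3] at h_one; linear_combination -h_one⟩
  · intro h l hl
    refine (mul_eq_zero.mp ?_).resolve_left (pow_ne_zero 2 hκ0)
    rw [sq_mul_gfun hκ0 hl]
    rcases h with ⟨h3, h⟩ | ⟨h2, h⟩
    · rw [h3]
      linear_combination h
    · rw [h2]
      linear_combination h
end
end

section
/- Let P ∈ ℂ[e, f, k, k′] be homogeneous of degree 2 and suppose P(v) = 0 for every v ∈ cone(C) ∪ cone(C′). Then there exist a, c ∈ ℂ such that P = a·(κ⁻²ef + k² + k′²) + c·kk′. (The quadrics Q(λ) are the only quadrics containing C ∪ C′.) -/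
noncomputable section

open MvPolynomial

/-- A homogeneous polynomial of degree two is a quadratic form in the variables. -/
theorem exists_eq_sum_of_isHomogeneous_two {σ R : Type*} [Fintype σ] [CommSemiring R]
    {P : MvPolynomial σ R} (hP : P.IsHomogeneous 2) :
    ∃ A : σ → σ → R, P = ∑ i, ∑ j, C (A i j) * (X i * X j) := by
  classical
  rw [P.as_sum]
  refine Finset.sum_induction _
    (fun Q : MvPolynomial σ R => ∃ A : σ → σ → R, Q = ∑ i, ∑ j, C (A i j) * (X i * X j))
    ?_ ⟨0, by simp⟩ fun d hd => ?_
  · rintro _ _ ⟨A, rfl⟩ ⟨B, rfl⟩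
    exact ⟨A + B, by simp [add_mul, Finset.sum_add_distrib]⟩
  · have hdeg : d.degree = 2 := by
      rw [← hP (mem_support_iff.mp hd), Finsupp.degree_eq_weight_one]
      rfl
    obtain ⟨i, hi⟩ : ∃ i, d i ≠ 0 := by
      by_contra! h
      obtain rfl : d = 0 := Finsupp.ext h
      simp at hdeg
    obtain ⟨d', rfl⟩ : ∃ d', d = Finsupp.single i 1 + d' :=
      le_iff_exists_add.mp (Finsupp.single_le_iff.mpr (Nat.one_le_iff_ne_zero.mpr hi))
    have hdeg' : d'.degree = 1 := by
      rw [map_add, Finsupp.degree_single] at hdeg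
      omega
    obtain ⟨j, rfl⟩ := (Finsupp.sum_eq_one_iff d').mp hdeg'
    refine ⟨fun a b => if a = i then if b = j then
      coeff (Finsupp.single i 1 + Finsupp.single j 1) P else 0 else 0, ?_⟩
    rw [Finset.sum_eq_single i (by simp +contextual) (by simp),
      Finset.sum_eq_single j (by simp +contextual) (by simp)]
    simp [X, C_mul_monomial, monomial_mul]

/-- The quadrics `Q(λ)` are the only quadrics containing `C ∪ C′`: every homogeneous
degree-2 polynomial `P ∈ ℂ[e,f,k,k′]` vanishing on `cone(C) ∪ cone(C′)` is of the form
`a·(κ⁻²ef + k² + k′²) + c·kk′`. Variables: `X 0 = e`, `X 1 = f`, `X 2 = k`, `X 3 = k′`. -/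
theorem stmt_8 (q κ : ℂ) (hq0 : q ≠ 0) (hq1 : q ≠ 1) (hqm1 : q ≠ -1)
    (hκ : κ = (q⁻¹ - q)⁻¹) (P : MvPolynomial (Fin 4) ℂ) (hP : P.IsHomogeneous 2)
    (hvanish : ∀ v : Fin 4 → ℂ,
      ((v 3 = 0 ∧ v 0 * v 1 + κ ^ 2 * (v 2) ^ 2 = 0) ∨
        (v 2 = 0 ∧ v 0 * v 1 + κ ^ 2 * (v 3) ^ 2 = 0)) → eval v P = 0) :
    ∃ a c : ℂ,
      P = C a * (C (κ ^ 2)⁻¹ * (X 0 * X 1) + X 2 ^ 2 + X 3 ^ 2) + C c * (X 2 * X 3) := by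
  have hκ0 : κ ≠ 0 := by
    rw [hκ]
    refine inv_ne_zero fun h => ?_
    have hsq : (q - 1) * (q + 1) = 0 := by
      field_simp at h
      linear_combination -h
    rcases mul_eq_zero.mp hsq with h | h
    · exact hq1 (sub_eq_zero.mp h)
    · exact hqm1 (eq_neg_of_add_eq_zero_left h)
  obtain ⟨A, rfl⟩ := exists_eq_sum_of_isHomogeneous_two hP
  have e0 := hvanish ![1, 0, 0, 0] (by simp)
  have e1 := hvanish ![0, 1, 0, 0] (by simp)
  have k1 := hvanish ![1, -κ ^ 2, 1, 0] (by simp)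
  have k2 := hvanish ![-1, κ ^ 2, 1, 0] (by simp)
  have k3 := hvanish ![2, -κ ^ 2 / 2, 1, 0] (by left; simp; ring)
  have l1 := hvanish ![1, -κ ^ 2, 0, 1] (by simp)
  have l2 := hvanish ![-1, κ ^ 2, 0, 1] (by simp)
  have l3 := hvanish ![2, -κ ^ 2 / 2, 0, 1] (by right; simp; ring)
  simp [Fin.sum_univ_four] at e0 e1 k1 k2 k3 l1 l2 l3
  simp only [e0, e1] at k1 k2 k3 l1 l2 l3
  have hκ2 : κ ^ 2 ≠ 0 := pow_ne_zero 2 hκ0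
  have h12 : A 2 1 = -A 1 2 := by
    refine mul_left_cancel₀ hκ2 ?_
    linear_combination (2 / 3) * (k3 - (k1 + k2) / 2) - (2 / 3) * (k1 - k2)
  have h02 : A 2 0 = -A 0 2 := by
    linear_combination (k1 - k2) / 2 + κ ^ 2 * h12
  have h13 : A 3 1 = -A 1 3 := by
    refine mul_left_cancel₀ hκ2 ?_
    linear_combination (2 / 3) * (l3 - (l1 + l2) / 2) - (2 / 3) * (l1 - l2)
  have h03 : A 3 0 = -A 0 3 := by
    linear_combination (l1 - l2) / 2 + κ ^ 2 * h13
  have h01 : A 1 0 = A 2 2 * (κ ^ 2)⁻¹ - A 0 1 := by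
    rw [eq_sub_iff_add_eq, eq_mul_inv_iff_mul_eq₀ hκ2]
    linear_combination -(k1 + k2) / 2
  have h33 : A 3 3 = A 2 2 := by
    linear_combination (l1 + l2) / 2 - (k1 + k2) / 2
  refine ⟨A 2 2, A 2 3 + A 3 2, ?_⟩
  simp only [Fin.sum_univ_four, e0, e1, h12, h02, h13, h03, h01, h33, map_add, map_sub, map_neg,
    map_mul, map_zero]
  ring
end
end
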